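/- Let k > 0 be an integer and let G be a finite simple graph. If tw(G) ≥ 12·(8k·log₂(8k) + 2)² − 4, then G contains a double wheel DW_r with r ≥ k as a minor. -/

import Mathlib

/-- `IsMinor H G` : there is a minor model of `H` in `G`. -/
def IsMinor {α : Type*} {β : Type*} (H : SimpleGraph α) (G : SimpleGraph β) : Prop :=
  ∃ M : α → Set β,
    (∀ v, (G.induce (M v)).Connected) ∧
    (Pairwise fun u v => Disjoint (M u) (M v)) ∧
    (∀ ⦃u v : α⦄, H.Adj u v → ∃ a ∈ M u, ∃ b ∈ M v, G.Adj a b)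

/-- The treewidth of a finite simple graph: the least `w` such that `G` admits a tree
decomposition all of whose bags have at most `w + 1` vertices. -/
noncomputable def treewidth {V : Type*} [Fintype V] (G : SimpleGraph V) : ℕ :=
  sInf { w : ℕ | ∃ (ι : Type) (_ : Fintype ι) (t : SimpleGraph ι) (bag : ι → Finset V),
    t.IsTree ∧
    (∀ v : V, ∃ i, v ∈ bag i) ∧
    (∀ u v : V, G.Adj u v → ∃ i, u ∈ bag i ∧ v ∈ bag i) ∧
    (∀ v : V, (t.induce {i : ι | v ∈ bag i}).Connected) ∧
    (∀ i, (bag i).card ≤ w + 1) }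

/-- The double wheel of order `r` : a cycle `w_1 … w_r` (the `inl` vertices) together
with two hubs `o_1, o_2` (the `inr` vertices), each adjacent to every cycle vertex. -/
def doubleWheel (r : ℕ) : SimpleGraph (Fin r ⊕ Fin 2) :=
  SimpleGraph.fromRel (fun u v =>
    match u, v with
    | Sum.inl i, Sum.inl j => (j : ℕ) = ((i : ℕ) + 1) % r
    | Sum.inl _, Sum.inr _ => True
    | _, _ => False)

namespace GraphConn

variable {V : Type*}

/-- `S` is nonempty and induces a connected subgraph of `G`, phrased through closed subsets. -/
def Conn (G : SimpleGraph V) (S : Set V) : Prop :=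
  S.Nonempty ∧ ∀ T : Set V, (S ∩ T).Nonempty →
    (∀ a ∈ S, a ∈ T → ∀ b ∈ S, G.Adj a b → b ∈ T) → S ⊆ T

theorem Conn.induce_connected {G : SimpleGraph V} {S : Set V} (h : Conn G S) :
    (G.induce S).Connected := by
  obtain ⟨⟨v, hv⟩, h⟩ := h
  rw [SimpleGraph.connected_iff_exists_forall_reachable]
  refine ⟨⟨v, hv⟩, ?_⟩
  have := h {x | ∃ hx : x ∈ S, (G.induce S).Reachable ⟨v, hv⟩ ⟨x, hx⟩}
    ⟨v, hv, hv, SimpleGraph.Reachable.refl _⟩ (by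
      rintro a ha ⟨_, hra⟩ b hb hab
      refine ⟨hb, hra.trans (SimpleGraph.Adj.reachable ?_)⟩
      simpa using hab)
  rintro ⟨w, hw⟩
  obtain ⟨_, h⟩ := this hw
  exact h

theorem conn_singleton (G : SimpleGraph V) (v : V) : Conn G {v} := by
  refine ⟨⟨v, rfl⟩, ?_⟩
  rintro T ⟨a, rfl, haT⟩ _ b rfl
  exact haT

theorem Conn.mono {G H : SimpleGraph V} {S : Set V} (h : Conn G S)
    (hGH : ∀ a ∈ S, ∀ b ∈ S, G.Adj a b → H.Adj a b) : Conn H S :=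
  ⟨h.1, fun T hT hc => h.2 T hT fun a ha haT b hb hab => hc a ha haT b hb (hGH a ha b hb hab)⟩

theorem Conn.subset_of_closed {G : SimpleGraph V} {S T : Set V} (h : Conn G S)
    (hT : (S ∩ T).Nonempty) (hc : ∀ a ∈ T, ∀ b, G.Adj a b → b ∈ T) : S ⊆ T :=
  h.2 T hT fun a _ ha b _ hab => hc a ha b hab

theorem Conn.iUnion_of_mem {G : SimpleGraph V} {ι : Sort*} {S : ι → Set V} {v : V}
    (i₀ : ι) (h : ∀ i, Conn G (S i)) (hv : ∀ i, v ∈ S i) : Conn G (⋃ i, S i) := by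
  refine ⟨⟨v, Set.mem_iUnion.2 ⟨i₀, hv i₀⟩⟩, ?_⟩
  rintro T ⟨a, haS, haT⟩ hc
  obtain ⟨i, hi⟩ := Set.mem_iUnion.1 haS
  have hsub : ∀ j, (S j ∩ T).Nonempty → S j ⊆ T := fun j hj =>
    (h j).2 T hj fun a ha haT b hb hab =>
      hc a (Set.mem_iUnion.2 ⟨j, ha⟩) haT b (Set.mem_iUnion.2 ⟨j, hb⟩) hab
  have hvT : v ∈ T := hsub i ⟨a, hi, haT⟩ (hv i)
  exact Set.iUnion_subset fun j => hsub j ⟨v, hv j, hvT⟩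

theorem Conn.union {G : SimpleGraph V} {S T : Set V} (hS : Conn G S) (hT : Conn G T)
    {v : V} (hvS : v ∈ S) (hvT : v ∈ T) : Conn G (S ∪ T) := by
  rw [Set.union_eq_iUnion]
  exact Conn.iUnion_of_mem true (by rintro (_ | _) <;> simpa) (v := v) (by rintro (_ | _) <;> simpa)

theorem conn_pair {G : SimpleGraph V} {a b : V} (hab : G.Adj a b) : Conn G {a, b} := by
  refine ⟨⟨a, by simp⟩, ?_⟩
  rintro T ⟨x, hx, hxT⟩ hc
  have hb := hab.symm
  rcases hx with rfl | rfl
  · have := hc x (by simp) hxT b (by simp) hab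
    simp [Set.insert_subset_iff, *]
  · have := hc x (by simp) hxT a (by simp) hb
    simp [Set.insert_subset_iff, *]

theorem Conn.union_of_adj {G : SimpleGraph V} {S T : Set V} (hS : Conn G S) (hT : Conn G T)
    {a b : V} (ha : a ∈ S) (hb : b ∈ T) (hab : G.Adj a b) : Conn G (S ∪ T) := by
  have h1 := hS.union (conn_pair hab) ha (by simp)
  have h2 := h1.union hT (v := b) (by simp) hb
  convert h2 using 1
  ext x; simp only [Set.mem_union, Set.mem_insert_iff, Set.mem_singleton_iff]
  grind

/-- The vertices reachable from `v` inside `S`. -/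
def comp (G : SimpleGraph V) (S : Set V) (v : V) : Set V :=
  ⋃ C : {C : Set V // Conn G C ∧ C ⊆ S ∧ v ∈ C}, C.1

theorem mem_comp_iff {G : SimpleGraph V} {S : Set V} {v x : V} :
    x ∈ comp G S v ↔ ∃ C, Conn G C ∧ C ⊆ S ∧ v ∈ C ∧ x ∈ C := by
  simp only [comp, Set.mem_iUnion, Subtype.exists, exists_prop]
  tauto

theorem comp_subset (G : SimpleGraph V) (S : Set V) (v : V) : comp G S v ⊆ S :=
  Set.iUnion_subset fun C => C.2.2.1

theorem self_mem_comp (G : SimpleGraph V) {S : Set V} {v : V} (hv : v ∈ S) : v ∈ comp G S v :=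
  mem_comp_iff.2 ⟨{v}, conn_singleton G v, by simpa, rfl, rfl⟩

theorem conn_comp (G : SimpleGraph V) {S : Set V} {v : V} (hv : v ∈ S) : Conn G (comp G S v) :=
  Conn.iUnion_of_mem ⟨{v}, conn_singleton G v, by simpa, rfl⟩ (fun C => C.2.1) fun C => C.2.2.2

theorem comp_closed {G : SimpleGraph V} {S : Set V} {v a b : V} (ha : a ∈ comp G S v)
    (hb : b ∈ S) (hab : G.Adj a b) : b ∈ comp G S v := by
  obtain ⟨C, hC, hCS, hv, haC⟩ := mem_comp_iff.1 ha
  refine mem_comp_iff.2 ⟨C ∪ {b}, hC.union_of_adj (conn_singleton G b) haC rfl hab, ?_, ?_, ?_⟩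
  · exact Set.union_subset hCS (by simpa)
  · exact Or.inl hv
  · exact Or.inr rfl

theorem Conn.subset_comp {G : SimpleGraph V} {C S : Set V} {v : V} (hC : Conn G C) (hCS : C ⊆ S)
    (hv : v ∈ C) : C ⊆ comp G S v :=
  fun _ hx => mem_comp_iff.2 ⟨C, hC, hCS, hv, hx⟩

/-- `(A, B)` is a separation of `G`. -/
def Sep (G : SimpleGraph V) (A B : Set V) : Prop :=
  (∀ v, v ∈ A ∨ v ∈ B) ∧ ∀ a b, a ∉ B → b ∉ A → ¬ G.Adj a b

theorem Sep.symm {G : SimpleGraph V} {A B : Set V} (h : Sep G A B) : Sep G B A :=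
  ⟨fun v => (h.1 v).symm, fun a b ha hb hab => h.2 b a hb ha hab.symm⟩

/-- The edges of `G` inside `A`. -/
def within (G : SimpleGraph V) (A : Set V) : SimpleGraph V where
  Adj u v := G.Adj u v ∧ u ∈ A ∧ v ∈ A
  symm := ⟨fun _ _ h => ⟨h.1.symm, h.2.2, h.2.1⟩⟩
  loopless := ⟨fun _ h => h.1.ne rfl⟩

/-- A linkage of size `k` from `X` to `Y`. -/
def Linked (G : SimpleGraph V) (X Y : Set V) (k : ℕ) : Prop :=
  ∃ P : Fin k → Set V, (∀ i, Conn G (P i)) ∧ (∀ i j, i ≠ j → Disjoint (P i) (P j)) ∧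
    (∀ i, ∃ x ∈ X, x ∈ P i) ∧ (∀ i, ∃ y ∈ Y, y ∈ P i)

theorem exists_bijective_of_disjoint [Finite V] {k : ℕ} {P : Fin k → Set V} {T : Set V}
    (hP : ∀ i j, i ≠ j → Disjoint (P i) (P j)) (hT : ∀ i, ∃ x ∈ T, x ∈ P i) (hk : T.ncard = k) :
    ∃ f : Fin k → V, Function.Injective f ∧ (∀ i, f i ∈ P i) ∧ (∀ i, f i ∈ T) ∧
      (∀ x ∈ T, ∃ i, f i = x) ∧ ∀ i, ∀ x ∈ T, x ∈ P i → x = f i := by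
  choose f hfT hfP using hT
  have hinj : Function.Injective f := by
    intro i j hij
    by_contra hne
    exact Set.disjoint_left.1 (hP i j hne) (hfP i) (hij ▸ hfP j)
  have hsurj : ∀ x ∈ T, ∃ i, f i = x := by
    have h1 : Set.range f = T := by
      apply Set.eq_of_subset_of_ncard_le (by rintro _ ⟨i, rfl⟩; exact hfT i) _ (Set.toFinite _)
      rw [hk, ← Set.image_univ, Set.ncard_image_of_injective _ hinj]
      simp
    intro x hx
    rw [← h1] at hx
    exact hx
  refine ⟨f, hinj, hfP, hfT, hsurj, fun i x hx hxi => ?_⟩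
  obtain ⟨j, rfl⟩ := hsurj x hx
  by_contra hne
  exact Set.disjoint_left.1 (hP i j (fun h => hne (h ▸ rfl))) hxi (hfP j)

theorem linked_of_sep [Finite V] (G : SimpleGraph V) (k : ℕ) : ∀ (X Y : Set V),
    (∀ A B, Sep G A B → X ⊆ A → Y ⊆ B → k ≤ (A ∩ B).ncard) → Linked G X Y k := by
  induction G using WellFoundedLT.induction with
  | ind G ih =>
  intro X Y h
  by_cases hE : ∃ a b, G.Adj a b
  · obtain ⟨a, b, hab⟩ := hE
    let G' : SimpleGraph V :=
      { Adj := fun u v => G.Adj u v ∧ ¬ ((u = a ∧ v = b) ∨ (u = b ∧ v = a))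
        symm := ⟨fun u v h => ⟨h.1.symm, by tauto⟩⟩
        loopless := ⟨fun u h => h.1.ne rfl⟩ }
    have hG' : G' < G := by
      refine lt_of_le_of_ne (fun u v h => h.1) fun he => ?_
      have : G'.Adj a b := by rw [he]; exact hab
      exact this.2 (Or.inl ⟨rfl, rfl⟩)
    by_cases hs : ∀ A B, Sep G' A B → X ⊆ A → Y ⊆ B → k ≤ (A ∩ B).ncard
    · obtain ⟨P, h1, h2⟩ := ih G' hG' X Y hs
      exact ⟨P, fun i => (h1 i).mono fun _ _ _ _ h => h.1, h2⟩
    push Not at hs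
    obtain ⟨A, B, hsep, hXA, hYB, hlt⟩ := hs
    have : ∃ a b, G.Adj a b ∧ a ∉ B ∧ b ∉ A ∧
        ∀ u v, G.Adj u v → u ∉ B → v ∉ A → u = a ∧ v = b := by
      by_contra hcon
      push Not at hcon
      refine absurd (h A B ⟨hsep.1, fun u v hu hv huv => ?_⟩ hXA hYB) (by omega)
      obtain ⟨u', v', h1, h2, h3, h4⟩ := hcon u v huv hu hv
      have h5 := hsep.2 u v hu hv
      have h6 := hsep.2 u' v' h2 h3
      have h7 := hsep.1 u
      have h8 := hsep.1 u'
      simp only [G', not_and, not_not] at h5 h6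
      grind
    obtain ⟨a, b, hab, haB, hbA, huniq⟩ := this
    have haA : a ∈ A := (hsep.1 a).resolve_right haB
    have hbB : b ∈ B := (hsep.1 b).resolve_left hbA
    have hca : (insert a (A ∩ B)).ncard = k := by
      have h1 := Set.ncard_insert_of_notMem (a := a) (s := A ∩ B) (fun h => haB h.2) (Set.toFinite _)
      have h2 := h A (insert a B) ⟨fun v => (hsep.1 v).imp id Or.inr, fun u v hu hv huv => by
        simp only [Set.mem_insert_iff, not_or] at hu
        exact hu.1 (huniq u v huv hu.2 hv).1⟩ hXA (hYB.trans (Set.subset_insert _ _))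
      rw [Set.inter_insert_of_mem haA] at h2
      omega
    have hcb : (insert b (A ∩ B)).ncard = k := by
      have h1 := Set.ncard_insert_of_notMem (a := b) (s := A ∩ B) (fun h => hbA h.1) (Set.toFinite _)
      have h2 := h (insert b A) B ⟨fun v => (hsep.1 v).imp Or.inr id, fun u v hu hv huv => by
        simp only [Set.mem_insert_iff, not_or] at hv
        exact hv.1 (huniq u v huv hu hv.2).2⟩ (hXA.trans (Set.subset_insert _ _)) hYB
      rw [Set.insert_inter_of_mem hbB] at h2
      omega
    have hlt' : ∀ C : Set V, ¬ (a ∈ C ∧ b ∈ C) → within G C < G := by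
      intro C hC
      refine lt_of_le_of_ne (fun u v h => h.1) fun he => hC ?_
      have : (within G C).Adj a b := by rw [he]; exact hab
      exact this.2
    obtain ⟨P, hPc, hPd, hPX, hPT⟩ := ih (within G A) (hlt' A fun h => hbA h.2) X
        (insert a (A ∩ B)) (by
      intro C D hCD hXC hTD
      have haD : a ∈ D := hTD (Set.mem_insert _ _)
      have hABD : ∀ v, v ∈ A → v ∈ B → v ∈ D := fun v h1 h2 => hTD (Or.inr ⟨h1, h2⟩)
      refine (h (C ∩ A) (D ∪ B) ⟨fun v => ?_, fun u v hu hv huv => ?_⟩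
        (Set.subset_inter hXC hXA) (hYB.trans Set.subset_union_right)).trans
        (Set.ncard_le_ncard ?_ (Set.toFinite _))
      · have := hCD.1 v
        have := hsep.1 v
        simp only [Set.mem_inter_iff, Set.mem_union]
        tauto
      · simp only [Set.mem_inter_iff, Set.mem_union, not_and, not_or] at hu hv
        have huA := (hsep.1 u).resolve_right hu.2
        have huC := (hCD.1 u).resolve_right hu.1
        by_cases hvA : v ∈ A
        · exact hCD.2 u v hu.1 (fun hvC => hv hvC hvA) ⟨huv, huA, hvA⟩
        · exact hu.1 ((huniq u v huv hu.2 hvA).1 ▸ haD)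
      · rintro v ⟨⟨h1, h2⟩, h3⟩
        exact ⟨h1, h3.elim id (hABD v h2)⟩)
    obtain ⟨Q, hQc, hQd, hQT, hQY⟩ := ih (within G B) (hlt' B fun h => haB h.1)
        (insert b (A ∩ B)) Y (by
      intro C D hCD hTC hYD
      have hbC : b ∈ C := hTC (Set.mem_insert _ _)
      have hABC : ∀ v, v ∈ A → v ∈ B → v ∈ C := fun v h1 h2 => hTC (Or.inr ⟨h1, h2⟩)
      refine (h (C ∪ A) (D ∩ B) ⟨fun v => ?_, fun u v hu hv huv => ?_⟩
        (hXA.trans Set.subset_union_right) (Set.subset_inter hYD hYB)).trans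
        (Set.ncard_le_ncard ?_ (Set.toFinite _))
      · have := hCD.1 v
        have := hsep.1 v
        simp only [Set.mem_inter_iff, Set.mem_union]
        tauto
      · simp only [Set.mem_inter_iff, Set.mem_union, not_and, not_or] at hu hv
        have hvB := (hsep.1 v).resolve_left hv.2
        have hvD := (hCD.1 v).resolve_left hv.1
        by_cases huB : u ∈ B
        · exact hCD.2 u v (fun huD => hu huD huB) hv.1 ⟨huv, huB, hvB⟩
        · exact hv.1 ((huniq u v huv huB hv.2).2 ▸ hbC)
      · rintro v ⟨h3, ⟨h1, h2⟩⟩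
        exact ⟨h3.elim id (fun h => hABC v h h2), h1⟩)
    have hPA : ∀ i, P i ⊆ A := fun i => (hPc i).subset_of_closed (by
      obtain ⟨x, hx, hxP⟩ := hPX i
      exact ⟨x, hxP, hXA hx⟩) fun _ _ _ h => h.2.2
    have hQB : ∀ i, Q i ⊆ B := fun i => (hQc i).subset_of_closed (by
      obtain ⟨x, hx, hxP⟩ := hQY i
      exact ⟨x, hxP, hYB hx⟩) fun _ _ _ h => h.2.2
    obtain ⟨f, hfi, hfP, hfT, hfs, hfu⟩ := exists_bijective_of_disjoint hPd hPT hca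
    obtain ⟨g, hgi, hgQ, hgT, hgs, hgu⟩ := exists_bijective_of_disjoint hQd (by simpa using hQT) hcb
    have : ∀ i, ∃ j, (f i = a ∧ g j = b) ∨ (f i ∈ A ∩ B ∧ g j = f i) := by
      intro i
      rcases hfT i with hi | hi
      · obtain ⟨j, hj⟩ := hgs b (Set.mem_insert _ _)
        exact ⟨j, Or.inl ⟨hi, hj⟩⟩
      · obtain ⟨j, hj⟩ := hgs (f i) (Or.inr hi)
        exact ⟨j, Or.inr ⟨hi, hj⟩⟩
    choose φ hφ using this
    have hφi : Function.Injective φ := by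
      intro i j hij
      apply hfi
      have h1 := hφ i
      have h2 := hφ j
      rw [← hij] at h2
      simp only [Set.mem_inter_iff] at h1 h2
      grind
    have hPQ : ∀ i j, i ≠ j → Disjoint (P i) (Q (φ j)) := by
      intro i j hij
      rw [Set.disjoint_left]
      intro x hxP hxQ
      have hxT : x ∈ A ∩ B := ⟨hPA i hxP, hQB _ hxQ⟩
      have h1 := hfu i x (Or.inr hxT) hxP
      have h2 := hgu _ x (Or.inr hxT) hxQ
      rcases hφ j with h3 | h3
      · rw [h3.2] at h2
        exact hbA (h2 ▸ hxT.1)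
      · exact hij (hfi (by rw [← h1, h2, h3.2]))
    refine ⟨fun i => P i ∪ Q (φ i), fun i => ?_, fun i j hij => ?_, fun i => ?_, fun i => ?_⟩
    · have h1 := (hPc i).mono (H := G) fun _ _ _ _ h => h.1
      have h2 := (hQc (φ i)).mono (H := G) fun _ _ _ _ h => h.1
      rcases hφ i with h3 | h3
      · exact h1.union_of_adj h2 (hfP i) (hgQ _) (by rw [h3.1, h3.2]; exact hab)
      · exact h1.union h2 (hfP i) (h3.2 ▸ hgQ (φ i))
    · rw [Set.disjoint_union_left, Set.disjoint_union_right, Set.disjoint_union_right]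
      exact ⟨⟨hPd i j hij, hPQ i j hij⟩, (hPQ j i hij.symm).symm, hQd _ _ fun h => hij (hφi h)⟩
    · obtain ⟨x, hx, hxP⟩ := hPX i
      exact ⟨x, hx, Or.inl hxP⟩
    · obtain ⟨x, hx, hxP⟩ := hQY (φ i)
      exact ⟨x, hx, Or.inr hxP⟩
  · push Not at hE
    have h1 := h X (Y ∪ Xᶜ) ⟨fun v => by by_cases v ∈ X <;> simp [*], fun a b _ _ => hE a b⟩
      subset_rfl Set.subset_union_left
    obtain ⟨t, ht, htc⟩ := Set.exists_subset_card_eq h1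
    have e : Fin k ≃ t := by
      have := Nat.card_coe_set_eq t
      rw [htc] at this
      exact (Finite.equivFinOfCardEq this).symm
    refine ⟨fun i => {(e i : V)}, fun i => conn_singleton _ _, fun i j hij => ?_, fun i => ?_,
      fun i => ?_⟩
    · simpa [Subtype.ext_iff] using fun h => hij (e.injective (Subtype.ext h))
    · exact ⟨e i, (ht (e i).2).1, rfl⟩
    · have := ht (e i).2
      simp only [Set.mem_inter_iff, Set.mem_union, Set.mem_compl_iff] at this
      exact ⟨e i, by tauto, rfl⟩

theorem isAcyclic_sum {α β : Type*} {G : SimpleGraph α} {H : SimpleGraph β} (hG : G.IsAcyclic)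
    (hH : H.IsAcyclic) : (G.sum H).IsAcyclic := by
  rw [SimpleGraph.isAcyclic_iff_forall_adj_isBridge] at *
  have hl : ∀ {v w : α} {x y : α ⊕ β}, ((G.sum H).deleteEdges {s(.inl v, .inl w)}).Walk x y →
      ∀ a, x = .inl a → ∃ b, y = .inl b ∧ (G.deleteEdges {s(v, w)}).Reachable a b := by
    intro v w x y p
    induction p with
    | nil => exact fun a ha => ⟨a, ha, SimpleGraph.Reachable.refl _⟩
    | @cons x z y hadj p ih =>
      rintro a rfl
      rcases z with c | c
      · obtain ⟨b, hb, hcb⟩ := ih c rfl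
        refine ⟨b, hb, SimpleGraph.Reachable.trans (SimpleGraph.Adj.reachable ?_) hcb⟩
        simpa using hadj
      · simp at hadj
  have hr : ∀ {v w : β} {x y : α ⊕ β}, ((G.sum H).deleteEdges {s(.inr v, .inr w)}).Walk x y →
      ∀ a, x = .inr a → ∃ b, y = .inr b ∧ (H.deleteEdges {s(v, w)}).Reachable a b := by
    intro v w x y p
    induction p with
    | nil => exact fun a ha => ⟨a, ha, SimpleGraph.Reachable.refl _⟩
    | @cons x z y hadj p ih =>
      rintro a rfl
      rcases z with c | c
      · simp at hadj
      · obtain ⟨b, hb, hcb⟩ := ih c rfl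
        refine ⟨b, hb, SimpleGraph.Reachable.trans (SimpleGraph.Adj.reachable ?_) hcb⟩
        simpa using hadj
  rintro (v | v) (w | w) hvw
  · rw [SimpleGraph.isBridge_iff]
    rintro ⟨p⟩
    obtain ⟨b, hb, h⟩ := hl p v rfl
    obtain rfl := Sum.inl.inj hb
    exact SimpleGraph.isBridge_iff.1 (hG (by simpa using hvw)) h
  · simp at hvw
  · simp at hvw
  · rw [SimpleGraph.isBridge_iff]
    rintro ⟨p⟩
    obtain ⟨b, hb, h⟩ := hr p v rfl
    obtain rfl := Sum.inr.inj hb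
    exact SimpleGraph.isBridge_iff.1 (hH (by simpa using hvw)) h

theorem Conn.image {α β : Type*} {G : SimpleGraph α} {H : SimpleGraph β} {S : Set α}
    (h : Conn G S) (f : α → β) (hf : ∀ a b, G.Adj a b → H.Adj (f a) (f b)) :
    Conn H (f '' S) := by
  refine ⟨h.1.image f, ?_⟩
  rintro T ⟨_, ⟨a, ha, rfl⟩, haT⟩ hc
  have := h.2 (f ⁻¹' T) ⟨a, ha, haT⟩ fun a ha haT b hb hab =>
    hc _ ⟨a, ha, rfl⟩ haT _ ⟨b, hb, rfl⟩ (hf _ _ hab)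
  rintro _ ⟨b, hb, rfl⟩
  exact this hb

/-- The subgraph of `G` induced by `U` has a tree decomposition with bags of size at most `m`,
one of which contains `X`. -/
def HasDec (G : SimpleGraph V) (m : ℕ) (U X : Set V) : Prop :=
  ∃ (ι : Type) (_ : Fintype ι) (t : SimpleGraph ι) (bag : ι → Finset V) (r : ι),
    t.IsTree ∧ (∀ i, ∀ v ∈ bag i, v ∈ U) ∧
    (∀ u ∈ U, ∀ v ∈ U, G.Adj u v → ∃ i, u ∈ bag i ∧ v ∈ bag i) ∧
    (∀ v ∈ U, Conn t {i | v ∈ bag i}) ∧ (∀ i, (bag i).card ≤ m) ∧ ∀ x ∈ X, x ∈ bag r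

theorem hasDec_of_ncard_le [Finite V] (G : SimpleGraph V) {m : ℕ} {U X : Set V}
    (hU : U.ncard ≤ m) (hX : X ⊆ U) : HasDec G m U X := by
  have hfin := Set.toFinite U
  refine ⟨Unit, inferInstance, ⊥, fun _ => hfin.toFinset, (), SimpleGraph.IsTree.of_subsingleton,
    by simp, by simpa using fun u hu v hv _ => ⟨hu, hv⟩, fun v hv => ?_, fun i => ?_, ?_⟩
  · convert conn_singleton (⊥ : SimpleGraph Unit) ()
    ext; simpa
  · rwa [← Set.ncard_eq_toFinset_card]
  · exact fun x hx => by simpa using hX hx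

theorem HasDec.glue {G : SimpleGraph V} {m : ℕ} {U₁ U₂ X₁ X₂ : Set V}
    (h₁ : HasDec G m U₁ X₁) (h₂ : HasDec G m U₂ X₂)
    (hI : ∀ v ∈ U₁, v ∈ U₂ → v ∈ X₁ ∧ v ∈ X₂)
    (hE : ∀ a ∈ U₁, a ∉ U₂ → ∀ b ∈ U₂, b ∉ U₁ → ¬ G.Adj a b) : HasDec G m (U₁ ∪ U₂) X₁ := by
  obtain ⟨ι₁, _, t₁, bag₁, r₁, ht₁, hs₁, he₁, hc₁, hm₁, hx₁⟩ := h₁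
  obtain ⟨ι₂, _, t₂, bag₂, r₂, ht₂, hs₂, he₂, hc₂, hm₂, hx₂⟩ := h₂
  let t := t₁.sum t₂ ⊔ SimpleGraph.edge (.inl r₁) (.inr r₂)
  have hinl : ∀ a b, t₁.Adj a b → t.Adj (.inl a) (.inl b) := fun a b h => Or.inl (by simpa)
  have hinr : ∀ a b, t₂.Adj a b → t.Adj (.inr a) (.inr b) := fun a b h => Or.inl (by simpa)
  have hset : ∀ v, {i | v ∈ Sum.elim bag₁ bag₂ i} =
      Sum.inl '' {i | v ∈ bag₁ i} ∪ Sum.inr '' {i | v ∈ bag₂ i} := by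
    intro v
    ext (i | i) <;> simp
  have he1 : ∀ v, v ∉ U₁ → {i | v ∈ bag₁ i} = ∅ := fun v hv =>
    Set.eq_empty_of_forall_notMem fun i hi => hv (hs₁ i v hi)
  have he2 : ∀ v, v ∉ U₂ → {i | v ∈ bag₂ i} = ∅ := fun v hv =>
    Set.eq_empty_of_forall_notMem fun i hi => hv (hs₂ i v hi)
  refine ⟨ι₁ ⊕ ι₂, inferInstance, t, Sum.elim bag₁ bag₂, .inl r₁, ⟨?_, ?_⟩, ?_, ?_, ?_, ?_, ?_⟩
  · exact ht₁.connected.sum_sup_edge ht₂.connected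
  · exact (isAcyclic_sum ht₁.isAcyclic ht₂.isAcyclic).sup_edge_of_not_reachable
      (SimpleGraph.not_reachable_sum_inl_inr _ _)
  · rintro (i | i) v hv
    · exact Or.inl (hs₁ i v hv)
    · exact Or.inr (hs₂ i v hv)
  · intro u hu v hv huv
    by_cases h1 : u ∈ U₁ ∧ v ∈ U₁
    · obtain ⟨i, hi⟩ := he₁ u h1.1 v h1.2 huv
      exact ⟨.inl i, hi⟩
    by_cases h2 : u ∈ U₂ ∧ v ∈ U₂
    · obtain ⟨i, hi⟩ := he₂ u h2.1 v h2.2 huv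
      exact ⟨.inr i, hi⟩
    exfalso
    have := hE u
    have := hE v
    have := huv.symm
    simp only [Set.mem_union] at hu hv
    grind
  · intro v hv
    rw [hset]
    by_cases h1 : v ∈ U₁ <;> by_cases h2 : v ∈ U₂
    · exact ((hc₁ v h1).image _ hinl).union_of_adj ((hc₂ v h2).image _ hinr)
        (a := .inl r₁) (b := .inr r₂) ⟨r₁, hx₁ v (hI v h1 h2).1, rfl⟩
        ⟨r₂, hx₂ v (hI v h1 h2).2, rfl⟩ (Or.inr (by simp [SimpleGraph.edge_adj]))
    · rw [he2 v h2, Set.image_empty, Set.union_empty]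
      exact (hc₁ v h1).image _ hinl
    · rw [he1 v h1, Set.image_empty, Set.empty_union]
      exact (hc₂ v h2).image _ hinr
    · exact absurd hv (by simp [h1, h2])
  · rintro (i | i)
    · exact hm₁ i
    · exact hm₂ i
  · exact hx₁

theorem HasDec.treewidth_le [Fintype V] {G : SimpleGraph V} {m : ℕ} {X : Set V}
    (h : HasDec G (m + 1) Set.univ X) : treewidth G ≤ m := by
  obtain ⟨ι, _, t, bag, r, ht, -, he, hc, hm, -⟩ := h
  refine Nat.sInf_le ⟨ι, ‹_›, t, bag, ht, fun v => ?_, fun u v huv => ?_, fun v => ?_, hm⟩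
  · exact (hc v trivial).1
  · exact he u trivial v trivial huv
  · exact (hc v trivial).induce_connected

theorem hasDec_of_forall_exists [Finite V] (G : SimpleGraph V) {w s : ℕ}
    (hno : ∀ W : Set V, W.ncard = w → ∃ S : Set V, S.ncard ≤ s ∧ ∀ C, Conn G C → Disjoint C S →
      (∀ a ∈ C, ∀ b, b ∉ S → G.Adj a b → b ∈ C) → S.ncard < (W \ C).ncard) (N : ℕ) :
    ∀ U W₀ : Set V, U.ncard ≤ N → W₀ ⊆ U → W₀.ncard ≤ w → HasDec G (w + s) U W₀ := by
  induction N with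
  | zero => exact fun U W₀ hU hW _ => hasDec_of_ncard_le G (by omega) hW
  | succ N ih =>
  intro U W₀ hU hW₀ hw
  by_cases hsmall : U.ncard ≤ w + s
  · exact hasDec_of_ncard_le G hsmall hW₀
  obtain ⟨W, hW₀W, hWU, hWw⟩ := Set.exists_subsuperset_card_eq hW₀ hw (by omega : w ≤ U.ncard)
  obtain ⟨S, hS, hSC⟩ := hno W hWw
  set R := W ∪ (S ∩ U) with hR
  have hRU : R ⊆ U := Set.union_subset hWU Set.inter_subset_right
  have hRcard : R.ncard ≤ w + s := (Set.ncard_union_le _ _).trans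
    (add_le_add hWw.le ((Set.ncard_le_ncard Set.inter_subset_left (Set.toFinite _)).trans hS))
  have hcomp : ∀ v ∈ U \ S, HasDec G (w + s) (comp G (U \ S) v ∪ (S ∩ U))
      ((W ∩ comp G (U \ S) v) ∪ (S ∩ U)) := by
    intro v hv
    have h1 : comp G (U \ S) v ⊆ comp G Sᶜ v := (conn_comp G hv).subset_comp
      ((comp_subset _ _ _).trans fun _ h => h.2) (self_mem_comp G hv)
    have h2 := hSC (comp G Sᶜ v) (conn_comp G hv.2)
      (Set.disjoint_left.2 fun x hx => comp_subset _ _ _ hx)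
      fun a ha b hb hab => comp_closed ha hb hab
    have h3 := Set.ncard_inter_add_ncard_sdiff_eq_ncard W (comp G Sᶜ v) (Set.toFinite _)
    have h4 : (W ∩ comp G (U \ S) v).ncard ≤ (W ∩ comp G Sᶜ v).ncard :=
      Set.ncard_le_ncard (Set.inter_subset_inter_right _ h1) (Set.toFinite _)
    have h5 : (S ∩ U).ncard ≤ S.ncard := Set.ncard_le_ncard Set.inter_subset_left (Set.toFinite _)
    have hsub : comp G (U \ S) v ∪ (S ∩ U) ⊆ U :=
      Set.union_subset ((comp_subset _ _ _).trans Set.sdiff_subset) Set.inter_subset_right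
    refine ih _ _ ?_ (Set.union_subset_union_left _ Set.inter_subset_right)
      ((Set.ncard_union_le _ _).trans (by omega))
    obtain ⟨x, hx, hxS⟩ := Set.exists_mem_notMem_of_ncard_lt_ncard h2
    have : (comp G (U \ S) v ∪ (S ∩ U)).ncard < U.ncard := by
      refine Set.ncard_lt_ncard ⟨hsub, fun h => ?_⟩ (Set.toFinite _)
      rcases h (hWU hx.1) with h | h
      · exact hx.2 (h1 h)
      · exact hxS h.1
    omega
  have key : ∀ F : Set V, F ⊆ U \ S → HasDec G (w + s) (R ∪ ⋃ v ∈ F, comp G (U \ S) v) R := by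
    intro F hF
    induction F, Set.toFinite F using Set.Finite.induction_on with
    | empty => simpa using hasDec_of_ncard_le G hRcard subset_rfl
    | @insert v F hvF _ ih =>
      have ih := ih ((Set.subset_insert _ _).trans hF)
      have hv := hF (Set.mem_insert _ _)
      have hclosed : ∀ a ∈ comp G (U \ S) v, ∀ b ∈ U, b ∉ S → G.Adj a b → b ∈ comp G (U \ S) v :=
        fun a ha b hb hbS hab => comp_closed ha ⟨hb, hbS⟩ hab
      have hFU : ∀ x ∈ ⋃ v ∈ F, comp G (U \ S) v, x ∈ U := by
        intro x hx
        simp only [Set.mem_iUnion] at hx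
        obtain ⟨v', -, hx⟩ := hx
        exact (comp_subset _ _ _ hx).1
      by_cases hmeet : ∃ x ∈ comp G (U \ S) v, x ∈ ⋃ v ∈ F, comp G (U \ S) v
      · obtain ⟨x, hxv, hx⟩ := hmeet
        simp only [Set.mem_iUnion] at hx
        obtain ⟨v', hv'F, hx⟩ := hx
        have hv' := hF (Set.mem_insert_of_mem _ hv'F)
        have : comp G (U \ S) v ⊆ comp G (U \ S) v' :=
          Set.subset_union_left.trans (((conn_comp G hv).union (conn_comp G hv') hxv hx).subset_comp
            (Set.union_subset (comp_subset _ _ _) (comp_subset _ _ _))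
            (Or.inr (self_mem_comp G hv')))
        rw [Set.biUnion_insert, Set.union_eq_self_of_subset_left
          (this.trans (Set.subset_biUnion_of_mem (u := fun v => comp G (U \ S) v) hv'F))]
        exact ih
      · push Not at hmeet
        have := ih.glue (hcomp v hv) (fun x hx hx' => ?_) (fun a ha ha' b hb hb' hab => ?_)
        · convert this using 1
          rw [Set.biUnion_insert]
          ext x
          simp only [hR, Set.mem_union]
          tauto
        · have := hmeet x
          simp only [hR, Set.mem_union, Set.mem_inter_iff] at hx hx' ⊢
          tauto
        · have haU : a ∈ U := ha.elim (fun h => hRU h) (hFU a)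
          have := hclosed b
          have := hab.symm
          simp only [hR, Set.mem_union, Set.mem_inter_iff] at ha' hb hb'
          grind
  obtain ⟨ι, inst, t, bag, r, h1, h2, h3, h4, h5, h6⟩ := key (U \ S) subset_rfl
  have hfull : R ∪ ⋃ v ∈ U \ S, comp G (U \ S) v = U := by
    refine Set.Subset.antisymm (Set.union_subset hRU (Set.iUnion₂_subset fun v _ =>
      (comp_subset _ _ _).trans Set.sdiff_subset)) fun x hx => ?_
    by_cases hxS : x ∈ S
    · exact Or.inl (Or.inr ⟨hxS, hx⟩)
    · exact Or.inr (Set.mem_biUnion (x := x) ⟨hx, hxS⟩ (self_mem_comp G ⟨hx, hxS⟩))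
  rw [hfull] at h2 h3 h4
  exact ⟨ι, inst, t, bag, r, h1, h2, h3, h4, h5, fun x hx => h6 x (Or.inl (hW₀W hx))⟩

/-- Large treewidth yields a highly connected set. -/
theorem exists_wellLinked_of_le_treewidth [Fintype V] (G : SimpleGraph V) {w s : ℕ}
    (hws : 0 < w + s) (h : w + s ≤ treewidth G) :
    ∃ W : Set V, W.ncard = w ∧ ∀ S : Set V, S.ncard ≤ s → ∃ C, Conn G C ∧ Disjoint C S ∧
      (∀ a ∈ C, ∀ b, b ∉ S → G.Adj a b → b ∈ C) ∧ (W \ C).ncard ≤ S.ncard := by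
  by_contra hcon
  push Not at hcon
  have hdec := hasDec_of_forall_exists G hcon _ Set.univ ∅ le_rfl (Set.empty_subset _) (by simp)
  obtain ⟨m, hm⟩ : ∃ m, w + s = m + 1 := ⟨w + s - 1, by omega⟩
  rw [hm] at hdec
  have := hdec.treewidth_le
  omega

theorem Conn.exists_interior {G : SimpleGraph V} {R : Set V} (h : Conn G R) {x y : V}
    (hx : x ∈ R) (hy : y ∈ R) (hne : x ≠ y) (hxy : ¬ G.Adj x y) :
    ∃ K, Conn G K ∧ K ⊆ R \ {x, y} ∧ (∃ a ∈ K, G.Adj x a) ∧ ∃ b ∈ K, G.Adj b y := by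
  by_contra hcon
  push Not at hcon
  let T : Set V := {c | c = x ∨ ∃ K, Conn G K ∧ K ⊆ R \ {x, y} ∧ c ∈ K ∧ ∃ a ∈ K, G.Adj x a}
  have hyT : y ∈ T := by
    refine h.2 T ⟨x, hx, Or.inl rfl⟩ ?_ hy
    rintro c hcR (rfl | ⟨K, hK, hKR, hcK, hxK⟩) b hb hcb
    · refine Or.inr ⟨{b}, conn_singleton G b, ?_, rfl, b, rfl, hcb⟩
      rintro _ rfl
      refine ⟨hb, ?_⟩
      rintro (rfl | rfl)
      · exact hcb.ne rfl
      · exact hxy hcb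
    · by_cases hbx : b = x
      · exact Or.inl hbx
      have hby : b ≠ y := by
        rintro rfl
        exact hcon K hK hKR hxK c hcK hcb
      obtain ⟨a, ha, hxa⟩ := hxK
      refine Or.inr ⟨K ∪ {b}, hK.union_of_adj (conn_singleton G b) hcK rfl hcb, ?_, Or.inr rfl,
        a, Or.inl ha, hxa⟩
      rintro c (hc | rfl)
      · exact hKR hc
      · exact ⟨hb, by simp [hbx, hby]⟩
  rcases hyT with h1 | ⟨K, -, hKR, hyK, -⟩
  · exact hne h1.symm
  · exact (hKR hyK).2 (by simp)

theorem exists_partition_extension [Finite V] {G : SimpleGraph V} {ι : Type*} {C : Set V}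
    (hC : Conn G C) (i₀ : ι) (N : ℕ) : ∀ (K : ι → Set V), (C \ ⋃ i, K i).ncard ≤ N →
    (∀ i, Conn G (K i)) → (∀ i j, i ≠ j → Disjoint (K i) (K j)) → (∀ i, K i ⊆ C) →
    ∃ L : ι → Set V, (∀ i, K i ⊆ L i) ∧ (∀ i, Conn G (L i)) ∧
      (∀ i j, i ≠ j → Disjoint (L i) (L j)) ∧ ⋃ i, L i = C := by
  classical
  induction N with
  | zero =>
    intro K hN hK hd hs
    refine ⟨K, fun _ => subset_rfl, hK, hd, Set.Subset.antisymm (Set.iUnion_subset hs) ?_⟩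
    rwa [Nat.le_zero, Set.ncard_eq_zero (Set.toFinite _), Set.sdiff_eq_empty] at hN
  | succ N ih =>
    intro K hN hK hd hs
    by_cases hfull : C ⊆ ⋃ i, K i
    · exact ⟨K, fun _ => subset_rfl, hK, hd, Set.Subset.antisymm (Set.iUnion_subset hs) hfull⟩
    have : ∃ a ∈ C, a ∈ (⋃ i, K i) ∧ ∃ b ∈ C, G.Adj a b ∧ b ∉ ⋃ i, K i := by
      by_contra hcon
      push Not at hcon
      obtain ⟨v, hv⟩ := (hK i₀).1
      exact hfull (hC.2 _ ⟨v, hs i₀ hv, Set.mem_iUnion.2 ⟨i₀, hv⟩⟩ hcon)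
    obtain ⟨a, haC, haK, b, hbC, hab, hbK⟩ := this
    obtain ⟨i, hai⟩ := Set.mem_iUnion.1 haK
    have hbK' : ∀ j, b ∉ K j := fun j hj => hbK (Set.mem_iUnion.2 ⟨j, hj⟩)
    have hsub : ∀ j, K j ⊆ Function.update K i (K i ∪ {b}) j := by
      intro j
      by_cases h : j = i
      · subst h; simp
      · simp [h]
    suffices h : (C \ ⋃ j, Function.update K i (K i ∪ {b}) j).ncard ≤ N ∧
        (∀ j, Conn G (Function.update K i (K i ∪ {b}) j)) ∧
        (∀ j j', j ≠ j' → Disjoint (Function.update K i (K i ∪ {b}) j)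
          (Function.update K i (K i ∪ {b}) j')) ∧
        ∀ j, Function.update K i (K i ∪ {b}) j ⊆ C by
      obtain ⟨L, h1, h2⟩ := ih _ h.1 h.2.1 h.2.2.1 h.2.2.2
      exact ⟨L, fun j => (hsub j).trans (h1 j), h2⟩
    refine ⟨?_, ?_, ?_, ?_⟩
    · have : (C \ ⋃ j, Function.update K i (K i ∪ {b}) j).ncard < (C \ ⋃ j, K j).ncard := by
        refine Set.ncard_lt_ncard ⟨Set.sdiff_subset_sdiff_right (Set.iUnion_mono hsub), ?_⟩
          (Set.toFinite _)
        intro h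
        refine (h ⟨hbC, hbK⟩).2 (Set.mem_iUnion.2 ⟨i, ?_⟩)
        simp
      omega
    · intro j
      by_cases h : j = i
      · subst h
        simpa using (hK j).union_of_adj (conn_singleton G b) hai rfl hab
      · simpa [h] using hK j
    · intro j j' hjj'
      have := hd j j' hjj'
      by_cases h : j = i <;> by_cases h' : j' = i
      · exact absurd (h.trans h'.symm) hjj'
      · subst h
        simpa [h', hbK'] using this
      · subst h'
        simpa [h, hbK'] using this
      · simpa [h, h'] using this
    · intro j
      by_cases h : j = i
      · subst h
        simpa using Set.insert_subset hbC (hs j)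
      · simpa [h] using hs j

theorem Conn.subset_side {G : SimpleGraph V} {A B C : Set V} (hC : Conn G C) (h : Sep G A B)
    (hd : Disjoint C (A ∩ B)) : C ⊆ A \ B ∨ C ⊆ B \ A := by
  rw [Set.disjoint_left] at hd
  by_cases hCA : (C ∩ A).Nonempty
  · left
    have := hC.2 A hCA fun a haC haA b hbC hab => by
      by_contra hbA
      exact h.2 a b (fun haB => hd haC ⟨haA, haB⟩) hbA hab
    exact fun x hx => ⟨this hx, fun hxB => hd hx ⟨this hx, hxB⟩⟩
  · right
    intro x hx
    have hxA : x ∉ A := fun h => hCA ⟨x, hx, h⟩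
    exact ⟨(h.1 x).resolve_left hxA, hxA⟩

/-- Removing at most `s` vertices `S` leaves a component missing at most `|S|` vertices of `W`. -/
def WellLinked (G : SimpleGraph V) (W : Set V) (s : ℕ) : Prop :=
  ∀ S : Set V, S.ncard ≤ s → ∃ C, Conn G C ∧ Disjoint C S ∧
      (∀ a ∈ C, ∀ b, b ∉ S → G.Adj a b → b ∈ C) ∧ (W \ C).ncard ≤ S.ncard

theorem WellLinked.side [Finite V] {G : SimpleGraph V} {W : Set V} {s : ℕ}
    (hW : WellLinked G W s) {A B : Set V} (h : Sep G A B) (hs : (A ∩ B).ncard ≤ s) :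
    (W ∩ A).ncard ≤ (A ∩ B).ncard ∨ (W ∩ B).ncard ≤ (A ∩ B).ncard := by
  obtain ⟨C, hC, hd, -, hcard⟩ := hW _ hs
  rcases hC.subset_side h hd with h1 | h1
  · right
    refine (Set.ncard_le_ncard ?_ (Set.toFinite _)).trans hcard
    exact fun x hx => ⟨hx.1, fun hxC => (h1 hxC).2 hx.2⟩
  · left
    refine (Set.ncard_le_ncard ?_ (Set.toFinite _)).trans hcard
    exact fun x hx => ⟨hx.1, fun hxC => (h1 hxC).2 hx.2⟩

theorem Sep.ncard_le [Finite V] {G : SimpleGraph V} {A B : Set V} (h : Sep G A B) (W : Set V) :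
    W.ncard ≤ (W ∩ A).ncard + (W ∩ B).ncard := by
  refine (Set.ncard_le_ncard ?_ (Set.toFinite _)).trans (Set.ncard_union_le _ _)
  intro x hx
  exact (h.1 x).imp (fun h => ⟨hx, h⟩) fun h => ⟨hx, h⟩

/-- A separation `(A, B)` of order `i`, with few vertices of `W` in `A`, whose side `A` carries a
model `M` of the forest `par` on `{0, …, i - 1}`, rooted at `A ∩ B` via `z`, and which cannot be
improved by a separation of smaller order further away from `A`. -/
structure RootedModel (G : SimpleGraph V) (W : Set V) (n : ℕ) (par : ℕ → ℕ) (i : ℕ)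
    (A B : Set V) (M : ℕ → Set V) (z : ℕ → V) : Prop where
  sep : Sep G A B
  big : (W ∩ A).ncard ≤ 2 * n
  conn : ∀ j < i, Conn G (M j)
  sub : ∀ j < i, M j ⊆ A
  disj : ∀ j < i, ∀ j' < i, j ≠ j' → Disjoint (M j) (M j')
  root : ∀ j < i, z j ∈ M j
  root_mem : ∀ j < i, z j ∈ B
  surj : ∀ x ∈ A, x ∈ B → ∃ j < i, x = z j
  uniq : ∀ j < i, ∀ x ∈ M j, x ∈ B → x = z j
  edge : ∀ j < i, par j ≠ j → ∃ a ∈ M j, ∃ b ∈ M (par j), G.Adj a b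
  tight : ∀ A' B', Sep G A' B' → (W ∩ A').ncard ≤ 2 * n → A ⊆ A' → B' ⊆ B → i ≤ (A' ∩ B').ncard

namespace RootedModel

variable {G : SimpleGraph V} {W : Set V} {n : ℕ} {par : ℕ → ℕ} {i : ℕ} {A B : Set V}
  {M : ℕ → Set V} {z : ℕ → V}

theorem root_inj (h : RootedModel G W n par i A B M z) {j j' : ℕ} (hj : j < i) (hj' : j' < i)
    (he : z j = z j') : j = j' := by
  by_contra hne
  exact Set.disjoint_left.1 (h.disj j hj j' hj' hne) (h.root j hj) (he ▸ h.root j' hj')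

theorem inter_eq (h : RootedModel G W n par i A B M z) : A ∩ B = z '' Set.Iio i := by
  ext x
  constructor
  · rintro ⟨h1, h2⟩
    obtain ⟨j, hj, rfl⟩ := h.surj x h1 h2
    exact ⟨j, hj, rfl⟩
  · rintro ⟨j, hj, rfl⟩
    exact ⟨h.sub j hj (h.root j hj), h.root_mem j hj⟩

theorem ncard_root (h : RootedModel G W n par i A B M z) {s : Set ℕ} (hs : ∀ j ∈ s, j < i) :
    (z '' s).ncard = s.ncard :=
  Set.InjOn.ncard_image fun j hj j' hj' he => h.root_inj (hs j hj) (hs j' hj') he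

theorem ncard_inter (h : RootedModel G W n par i A B M z) : (A ∩ B).ncard = i := by
  rw [h.inter_eq, h.ncard_root (s := Set.Iio i) fun j hj => hj]
  simp [Set.ncard_eq_toFinset_card']

theorem exists_maximal [Finite V] (hn : 0 < n) (hWn : W.ncard = 6 * n - 1)
    (hW : WellLinked G W (2 * n)) (hi : i ≤ 2 * n)
    (h : ∃ A B M z, RootedModel G W n par i A B M z) :
    ∃ A B M z, RootedModel G W n par i A B M z ∧ Conn G Aᶜ ∧
      (∀ x ∈ A, x ∈ B → ∃ c, c ∉ A ∧ G.Adj x c) ∧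
      ∀ A' B' M' z', RootedModel G W n par i A' B' M' z' → A'.ncard ≤ A.ncard := by
  obtain ⟨A, hA, hmax⟩ := Set.exists_max_image
    {A : Set V | ∃ B M z, RootedModel G W n par i A B M z} Set.ncard (Set.toFinite _) h
  obtain ⟨B, M, z, h⟩ := hA
  have hmax' : ∀ A' B' M' z', RootedModel G W n par i A' B' M' z' → A'.ncard ≤ A.ncard :=
    fun A' B' M' z' h' => hmax A' ⟨B', M', z', h'⟩
  have hord := h.ncard_inter
  obtain ⟨C, hC, hd, hcl, hcard⟩ := hW (A ∩ B) (by omega)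
  have hCB : C ⊆ B \ A := by
    rcases hC.subset_side h.sep hd with h1 | h1
    · exfalso
      have h2 : (W ∩ C).ncard ≤ (W ∩ A).ncard :=
        Set.ncard_le_ncard (Set.inter_subset_inter_right _ fun x hx => (h1 hx).1) (Set.toFinite _)
      have h3 := Set.ncard_inter_add_ncard_sdiff_eq_ncard W C
      have h4 := h.big
      omega
    · exact h1
  have hAC : A ⊆ Cᶜ := fun x hx hxC => (hCB hxC).2 hx
  have hCZB : C ∪ (A ∩ B) ⊆ B := Set.union_subset (fun x hx => (hCB hx).1) Set.inter_subset_right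
  have hnew : RootedModel G W n par i Cᶜ (C ∪ (A ∩ B)) M z :=
    { sep := by
        refine ⟨fun v => ?_, fun a b ha hb hab => ?_⟩
        · by_cases hv : v ∈ C <;> simp [hv]
        · simp only [Set.mem_union, not_or] at ha
          exact ha.1 (hcl b (by simpa using hb) a ha.2 hab.symm)
      big := by
        have : W ∩ Cᶜ = W \ C := rfl
        rw [this]
        omega
      conn := h.conn
      sub := fun j hj => (h.sub j hj).trans hAC
      disj := h.disj
      root := h.root
      root_mem := fun j hj => Or.inr ⟨h.sub j hj (h.root j hj), h.root_mem j hj⟩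
      surj := fun x hx hx' => by
        rcases hx' with hx' | hx'
        · exact absurd hx' hx
        · exact h.surj x hx'.1 hx'.2
      uniq := fun j hj x hx hx' => h.uniq j hj x hx (hCZB hx')
      edge := h.edge
      tight := fun A' B' hs hb hA hB =>
        h.tight A' B' hs hb (hAC.trans hA) (hB.trans hCZB) }
  have hAeq : A = Cᶜ := Set.eq_of_subset_of_ncard_le hAC (hmax' _ _ _ _ hnew) (Set.toFinite _)
  refine ⟨A, B, M, z, h, ?_, ?_, hmax'⟩
  · rwa [hAeq, compl_compl]
  · by_contra hcon
    push Not at hcon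
    obtain ⟨x, hxA, hxB, hx⟩ := hcon
    have h1 := h.tight A (B \ {x}) ⟨fun v => ?_, fun a b ha hb hab => ?_⟩ h.big subset_rfl
      Set.sdiff_subset
    · have h2 : (A ∩ (B \ {x})).ncard < (A ∩ B).ncard := by
        refine Set.ncard_lt_ncard ⟨Set.inter_subset_inter_right _ Set.sdiff_subset, fun h => ?_⟩
          (Set.toFinite _)
        exact (h ⟨hxA, hxB⟩).2.2 rfl
      omega
    · by_cases hv : v = x
      · exact Or.inl (hv ▸ hxA)
      · exact (h.sep.1 v).imp id fun h => ⟨h, hv⟩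
    · by_cases hax : a = x
      · exact hx b hb (hax ▸ hab)
      · exact h.sep.2 a b (fun h => ha ⟨h, hax⟩) hb hab

/-- A rooted model extends along linkages to any further separation of the same order. -/
theorem push [Finite V] (h : RootedModel G W n par i A B M z)
    {A' B' : Set V} (hs : Sep G A' B')
    (hb : (W ∩ A').ncard ≤ 2 * n) (hA : A ⊆ A') (hB : B' ⊆ B) (hi : (A' ∩ B').ncard = i) :
    ∃ M' z', RootedModel G W n par i A' B' M' z' := by
  obtain ⟨P, hPc, hPd, hPZ, hPZ'⟩ := linked_of_sep (within G (A' ∩ B)) i (A ∩ B) (A' ∩ B') (by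
    intro C D hCD hZC hZD
    refine (h.tight (A ∪ (A' ∩ C)) (B' ∪ (B ∩ D)) ⟨fun v => ?_, fun u v hu hv huv => ?_⟩
      ((Set.ncard_le_ncard (Set.inter_subset_inter_right _
        (Set.union_subset hA Set.inter_subset_left)) (Set.toFinite _)).trans hb)
      Set.subset_union_left (Set.union_subset hB Set.inter_subset_left)).trans
      (Set.ncard_le_ncard ?_ (Set.toFinite _))
    · have h1 := h.sep.1 v
      have h2 := hs.1 v
      have h3 := hCD.1 v
      simp only [Set.mem_union, Set.mem_inter_iff]
      tauto
    · simp only [Set.mem_union, Set.mem_inter_iff, not_or, not_and] at hu hv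
      have hvB := (h.sep.1 v).resolve_left hv.1
      have huA' := (hs.1 u).resolve_right hu.1
      have hvA' : v ∈ A' := by
        by_contra hvA'
        exact hs.2 u v hu.1 hvA' huv
      have huB : u ∈ B := by
        by_contra huB
        exact h.sep.2 u v huB hv.1 huv
      exact hCD.2 u v (hu.2 huB) (hv.2 hvA') ⟨huv, ⟨huA', huB⟩, hvA', hvB⟩
    · rintro x ⟨h1, h2⟩
      have h3 := @hZC x
      have h4 := @hZD x
      have h5 := @hA x
      have h6 := @hB x
      simp only [Set.mem_union, Set.mem_inter_iff] at h1 h2 h3 h4 ⊢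
      tauto)
  have hPsub : ∀ t, P t ⊆ A' ∩ B := fun t => (hPc t).subset_of_closed (by
    obtain ⟨x, hx, hxP⟩ := hPZ t
    exact ⟨x, hxP, hA hx.1, hx.2⟩) fun _ _ _ h => h.2.2
  obtain ⟨f, hfi, hfP, hfT, hfs, hfu⟩ := exists_bijective_of_disjoint hPd hPZ h.ncard_inter
  obtain ⟨g, hgi, hgP, hgT, hgs, hgu⟩ := exists_bijective_of_disjoint hPd hPZ' hi
  rcases Nat.eq_zero_or_pos i with rfl | hi0
  · refine ⟨M, z, hs, hb, by simp, by simp, by simp, by simp, by simp, fun x hx hx' => ?_, by simp,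
      by simp, by simp⟩
    rw [Set.ncard_eq_zero (Set.toFinite _)] at hi
    exact absurd (show x ∈ A' ∩ B' from ⟨hx, hx'⟩) (by simp [hi])
  have : ∀ j, ∃ t, j < i → f t = z j := by
    intro j
    by_cases hj : j < i
    · obtain ⟨t, ht⟩ := hfs (z j) ⟨h.sub j hj (h.root j hj), h.root_mem j hj⟩
      exact ⟨t, fun _ => ht⟩
    · exact ⟨⟨0, hi0⟩, fun h => absurd h hj⟩
  choose φ hφ using this
  have hφi : ∀ j < i, ∀ j' < i, φ j = φ j' → j = j' := fun j hj j' hj' he =>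
    h.root_inj hj hj' (by rw [← hφ j hj, ← hφ j' hj', he])
  have hMP : ∀ j < i, ∀ j' < i, ∀ x ∈ M j, x ∈ P (φ j') → j = j' := by
    intro j hj j' hj' x hxM hxP
    have hxA := h.sub j hj hxM
    have hxB := (hPsub _ hxP).2
    refine h.root_inj hj hj' ?_
    rw [← h.uniq j hj x hxM hxB, ← hφ j' hj']
    exact hfu _ x ⟨hxA, hxB⟩ hxP
  refine ⟨fun j => M j ∪ P (φ j), fun j => g (φ j), ?_⟩
  exact
    { sep := hs
      big := hb
      conn := fun j hj => (h.conn j hj).union ((hPc _).mono fun _ _ _ _ h => h.1) (h.root j hj)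
        (hφ j hj ▸ hfP _)
      sub := fun j hj => Set.union_subset ((h.sub j hj).trans hA)
        ((hPsub _).trans Set.inter_subset_left)
      disj := fun j hj j' hj' hne => by
        rw [Set.disjoint_union_left, Set.disjoint_union_right, Set.disjoint_union_right]
        refine ⟨⟨h.disj j hj j' hj' hne, ?_⟩, ?_, hPd _ _ fun he => hne (hφi j hj j' hj' he)⟩
        · exact Set.disjoint_left.2 fun x hx hx' => hne (hMP j hj j' hj' x hx hx')
        · exact Set.disjoint_left.2 fun x hx hx' => hne (hMP j' hj' j hj x hx' hx).symm
      root := fun j hj => Or.inr (hgP _)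
      root_mem := fun j hj => (hgT _).2
      surj := fun x hx hx' => by
        obtain ⟨t, rfl⟩ := hgs x ⟨hx, hx'⟩
        obtain ⟨j, hj, hjt⟩ := h.surj (f t) (hfT t).1 (hfT t).2
        refine ⟨j, hj, ?_⟩
        rw [hfi (hjt.trans (hφ j hj).symm)]
      uniq := fun j hj x hx hx' => by
        rcases hx with hx | hx
        · have hxA := h.sub j hj hx
          refine hgu _ x ⟨hA hxA, hx'⟩ ?_
          rw [h.uniq j hj x hx (hB hx'), ← hφ j hj]
          exact hfP _
        · exact hgu _ x ⟨(hPsub _ hx).1, hx'⟩ hx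
      edge := fun j hj hne => by
        obtain ⟨a, ha, b, hb, hab⟩ := h.edge j hj hne
        exact ⟨a, Or.inl ha, b, Or.inl hb, hab⟩
      tight := fun A'' B'' hs' hb' hA' hB' =>
        h.tight A'' B'' hs' hb' (hA.trans hA') (hB'.trans hB) }

theorem exists_succ [Finite V] (hn : 0 < n) (hWn : W.ncard = 6 * n - 1)
    (hW : WellLinked G W (2 * n)) (hpar : ∀ j, par j ≤ j) (hi : i < 2 * n)
    (h : ∃ A B M z, RootedModel G W n par i A B M z) :
    ∃ A B M z, RootedModel G W n par (i + 1) A B M z := by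
  obtain ⟨A, B, M, z, h, hC, hnb, hmax⟩ := exists_maximal hn hWn hW hi.le h
  have : ∃ v, v ∉ A ∧ (par i ≠ i → G.Adj v (z (par i))) := by
    by_cases hp : par i = i
    · obtain ⟨v, hv⟩ := hC.1
      exact ⟨v, hv, fun h => absurd hp h⟩
    · have hlt : par i < i := lt_of_le_of_ne (hpar i) hp
      obtain ⟨c, hc, hadj⟩ := hnb _ (h.sub _ hlt (h.root _ hlt)) (h.root_mem _ hlt)
      exact ⟨c, hc, fun _ => hadj.symm⟩
  obtain ⟨v, hvA, hv⟩ := this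
  have hvB : v ∈ B := (h.sep.1 v).resolve_left hvA
  have hsep : Sep G (insert v A) B := ⟨fun x => (h.sep.1 x).imp Or.inr id, fun a b ha hb =>
    h.sep.2 a b ha fun h => hb (Or.inr h)⟩
  have hord : (insert v A ∩ B).ncard = i + 1 := by
    rw [Set.insert_inter_of_mem hvB, Set.ncard_insert_of_notMem (fun h => hvA h.1) (Set.toFinite _),
      h.ncard_inter]
  have hbig : (W ∩ insert v A).ncard ≤ 2 * n := by
    have h1 := hW.side hsep (by omega)
    have h2 := h.sep.ncard_le W
    have h3 := h.big
    omega
  have hvM : ∀ j < i, v ∉ M j := fun j hj h' => hvA (h.sub j hj h')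
  by_cases ht : ∀ A' B', Sep G A' B' → (W ∩ A').ncard ≤ 2 * n → insert v A ⊆ A' → B' ⊆ B →
      i + 1 ≤ (A' ∩ B').ncard
  · have hM : ∀ j < i, Function.update M i {v} j = M j := fun j hj => by simp [hj.ne]
    have hz : ∀ j < i, Function.update z i v j = z j := fun j hj => by simp [hj.ne]
    have hMi : Function.update M i {v} i = {v} := by simp
    have hzi : Function.update z i v i = v := by simp
    have hsucc : ∀ {q : ℕ → Prop}, (∀ j < i, q j) → q i → ∀ j < i + 1, q j := by
      intro q h1 h2 j hj
      rcases Nat.lt_succ_iff_lt_or_eq.1 hj with h | rfl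
      · exact h1 j h
      · exact h2
    refine ⟨insert v A, B, Function.update M i {v}, Function.update z i v, ?_⟩
    exact
      { sep := hsep
        big := hbig
        conn := hsucc (fun j hj => hM j hj ▸ h.conn j hj) (by rw [hMi]; exact conn_singleton G v)
        sub := hsucc (fun j hj => hM j hj ▸ (h.sub j hj).trans (Set.subset_insert _ _))
          (by simp)
        disj := hsucc
          (fun j hj => hsucc (fun j' hj' => by rw [hM j hj, hM j' hj']; exact h.disj j hj j' hj')
            (by rw [hM j hj, hMi]; simpa using fun _ => hvM j hj))
          (hsucc (fun j hj => by rw [hM j hj, hMi]; simpa using fun _ => hvM j hj) (by simp))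
        root := hsucc (fun j hj => by rw [hM j hj, hz j hj]; exact h.root j hj) (by simp)
        root_mem := hsucc (fun j hj => by rw [hz j hj]; exact h.root_mem j hj) (by simpa)
        surj := fun x hx hx' => by
          rcases hx with rfl | hx
          · exact ⟨i, by omega, by simp⟩
          · obtain ⟨j, hj, rfl⟩ := h.surj x hx hx'
            exact ⟨j, by omega, (hz j hj).symm⟩
        uniq := hsucc (fun j hj => by rw [hM j hj, hz j hj]; exact h.uniq j hj) (by simp)
        edge := hsucc (fun j hj hp => by
            rw [hM j hj, hM _ ((hpar j).trans_lt hj)]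
            exact h.edge j hj hp)
          (fun hp => by
            have hlt : par i < i := lt_of_le_of_ne (hpar i) hp
            rw [hMi, hM _ hlt]
            exact ⟨v, rfl, _, h.root _ hlt, hv hp⟩)
        tight := ht }
  · push Not at ht
    obtain ⟨A', B', hs', hb', hA', hB', hlt⟩ := ht
    have hge := h.tight A' B' hs' hb' ((Set.subset_insert _ _).trans hA') hB'
    obtain ⟨M', z', h'⟩ := h.push hs' hb' ((Set.subset_insert _ _).trans hA') hB' (by omega)
    have h1 := hmax _ _ _ _ h'
    have h2 := Set.ncard_le_ncard hA' (Set.toFinite _)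
    rw [Set.ncard_insert_of_notMem hvA (Set.toFinite _)] at h2
    omega

theorem exists_of_wellLinked [Finite V] (hn : 0 < n) (hWn : W.ncard = 6 * n - 1)
    (hW : WellLinked G W (2 * n)) (hpar : ∀ j, par j ≤ j) (hi : i ≤ 2 * n) [Nonempty V] :
    ∃ A B M z, RootedModel G W n par i A B M z := by
  induction i with
  | zero =>
    refine ⟨∅, Set.univ, fun _ => ∅, fun _ => Classical.arbitrary V, ?_⟩
    constructor <;> simp [Sep]
  | succ i ih => exact exists_succ hn hWn hW hpar (by omega) (ih (by omega))

end RootedModel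

/-- The graph on indices recording which sets touch. -/
def touch {ι : Type*} (G : SimpleGraph V) (K : ι → Set V) : SimpleGraph ι where
  Adj i j := i ≠ j ∧ ∃ a ∈ K i, ∃ b ∈ K j, G.Adj a b
  symm := ⟨fun _ _ ⟨h, a, ha, b, hb, hab⟩ => ⟨h.symm, b, hb, a, ha, hab.symm⟩⟩
  loopless := ⟨fun _ h => h.1 rfl⟩

theorem conn_touch {ι : Type*} [Nonempty ι] {G : SimpleGraph V} {K : ι → Set V}
    (hK : ∀ i, (K i).Nonempty) (hd : ∀ i j, i ≠ j → Disjoint (K i) (K j))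
    (h : Conn G (⋃ i, K i)) : Conn (touch G K) Set.univ := by
  refine ⟨Set.univ_nonempty, ?_⟩
  rintro T ⟨i, -, hi⟩ hc
  obtain ⟨v, hv⟩ := hK i
  have hsub := h.2 {x | ∃ i ∈ T, x ∈ K i} ⟨v, Set.mem_iUnion.2 ⟨i, hv⟩, i, hi, hv⟩ (by
    rintro a - ⟨j, hj, haj⟩ b hb hab
    obtain ⟨j', hbj'⟩ := Set.mem_iUnion.1 hb
    by_cases hjj : j = j'
    · exact ⟨j, hj, hjj ▸ hbj'⟩
    · exact ⟨j', hc j trivial hj j' trivial ⟨hjj, a, haj, b, hbj', hab⟩, hbj'⟩)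
  intro j _
  obtain ⟨x, hx⟩ := hK j
  obtain ⟨j', hj', hx'⟩ := hsub (Set.mem_iUnion.2 ⟨j, hx⟩)
  by_contra hj
  exact Set.disjoint_left.1 (hd j j' fun h => hj (h ▸ hj')) hx hx'

theorem exists_crossing [Finite V] {G : SimpleGraph V} {W : Set V} {n : ℕ} (hn : 0 < n)
    (hWn : W.ncard = 6 * n - 1) (hW : WellLinked G W (2 * n)) {par : ℕ → ℕ}
    (hpar : ∀ j, par j ≤ j) :
    ∃ (M : ℕ → Set V) (K : Fin n → Set V) (a b : Fin n → ℕ),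
      (∀ j < 2 * n, Conn G (M j)) ∧
      (∀ j < 2 * n, ∀ j' < 2 * n, j ≠ j' → Disjoint (M j) (M j')) ∧
      (∀ j < 2 * n, par j ≠ j → ∃ x ∈ M j, ∃ y ∈ M (par j), G.Adj x y) ∧
      (∀ i, Conn G (K i)) ∧ (∀ i i', i ≠ i' → Disjoint (K i) (K i')) ∧
      (∀ i, ∀ j < 2 * n, Disjoint (K i) (M j)) ∧
      (∀ i, a i < n) ∧ Function.Injective a ∧ (∀ i, n ≤ b i ∧ b i < 2 * n) ∧
      Function.Injective b ∧
      (∀ i, ∃ x ∈ M (a i), ∃ y ∈ K i, G.Adj x y) ∧ (∀ i, ∃ x ∈ M (b i), ∃ y ∈ K i, G.Adj x y) ∧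
      Conn (touch G K) Set.univ := by
  have hne : Nonempty V := by
    obtain ⟨C, ⟨⟨v, -⟩, -⟩, -⟩ := hW ∅ (by simp)
    exact ⟨v⟩
  obtain ⟨A, B, M, z, h, hC, -, -⟩ := RootedModel.exists_maximal hn hWn hW le_rfl
    (RootedModel.exists_of_wellLinked hn hWn hW hpar le_rfl)
  set X := z '' Set.Iio n with hX
  set Y := z '' Set.Ico n (2 * n) with hY
  have hXY : ∀ x, x ∈ A → x ∈ B → x ∈ X ∨ x ∈ Y := by
    intro x hxA hxB
    obtain ⟨j, hj, rfl⟩ := h.surj x hxA hxB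
    rcases lt_or_ge j n with hjn | hjn
    · exact Or.inl ⟨j, hjn, rfl⟩
    · exact Or.inr ⟨j, ⟨hjn, hj⟩, rfl⟩
  have hXZ : ∀ x ∈ X, x ∈ A ∧ x ∈ B := by
    rintro _ ⟨j, hj, rfl⟩
    have hj : j < 2 * n := by simp only [Set.mem_Iio] at hj; omega
    exact ⟨h.sub j hj (h.root j hj), h.root_mem j hj⟩
  have hYZ : ∀ x ∈ Y, x ∈ A ∧ x ∈ B := by
    rintro _ ⟨j, hj, rfl⟩
    exact ⟨h.sub j hj.2 (h.root j hj.2), h.root_mem j hj.2⟩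
  have hXc : X.ncard = n := by
    rw [hX, h.ncard_root (s := Set.Iio n) fun j hj => by simp only [Set.mem_Iio] at hj; omega]
    simp [Set.ncard_eq_toFinset_card']
  have hYc : Y.ncard = n := by
    rw [hY, h.ncard_root (s := Set.Ico n (2 * n)) fun j hj => hj.2]
    simp only [Set.ncard_eq_toFinset_card', Set.toFinset_Ico, Nat.card_Ico]
    omega
  let H : SimpleGraph V :=
    { Adj := fun u v => G.Adj u v ∧ u ∈ B ∧ v ∈ B ∧ ¬ (u ∈ A ∧ v ∈ A)
      symm := ⟨fun _ _ h => ⟨h.1.symm, h.2.2.1, h.2.1, fun h' => h.2.2.2 h'.symm⟩⟩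
      loopless := ⟨fun _ h => h.1.ne rfl⟩ }
  have hHG : ∀ a b, H.Adj a b → G.Adj a b := fun a b h => h.1
  have hside : ∀ C D, Sep H C D → ∀ X₀ ⊆ C, X₀.ncard = n → (∀ x, x ∈ A → x ∈ B → x ∈ X₀ ∨ x ∈ D) →
      (C ∩ D).ncard < n → (W ∩ (C ∩ B)).ncard ≤ 2 * n - 1 := by
    intro C D hCD X₀ hXC hX₀ hZ hlt
    have hord : ((A ∪ (D ∩ B)) ∩ (C ∩ B)).ncard ≤ 2 * n - 1 := by
      have : (A ∪ (D ∩ B)) ∩ (C ∩ B) ⊆ X₀ ∪ (C ∩ D) := by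
        intro x hx
        have := hZ x
        simp only [Set.mem_inter_iff, Set.mem_union] at hx ⊢
        tauto
      have h1 := Set.ncard_le_ncard this (Set.toFinite _)
      have h2 := Set.ncard_union_le X₀ (C ∩ D)
      omega
    have hs : Sep G (A ∪ (D ∩ B)) (C ∩ B) := by
      refine ⟨fun v => ?_, fun u v hu hv huv => ?_⟩
      · have h1 := h.sep.1 v
        have h2 := hCD.1 v
        simp only [Set.mem_union, Set.mem_inter_iff]
        tauto
      · simp only [Set.mem_union, Set.mem_inter_iff, not_or, not_and] at hu hv
        have hvB := (h.sep.1 v).resolve_left hv.1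
        have huB : u ∈ B := by
          by_contra huB
          exact h.sep.2 u v huB hv.1 huv
        exact hCD.2 v u (fun hvD => hv.2 hvD hvB) (fun huC => hu huC huB)
          ⟨huv.symm, hvB, huB, fun h => hv.1 h.1⟩
    rcases hW.side hs (by omega) with h1 | h1
    · have := h.tight _ _ hs (by omega) Set.subset_union_left Set.inter_subset_right
      omega
    · omega
  obtain ⟨R, hRc, hRd, hRX, hRY⟩ := linked_of_sep H n X Y (by
    intro C D hCD hXC hYD
    by_contra hlt
    push Not at hlt
    have h1 := hside C D hCD X hXC hXc (fun x hA hB => (hXY x hA hB).imp id fun h => hYD h) hlt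
    have h2 := hside D C hCD.symm Y hYD hYc
      (fun x hA hB => (hXY x hA hB).symm.imp id fun h => hXC h) (by rwa [Set.inter_comm])
    have h3 := h.big
    have h4 : W.ncard ≤ (W ∩ A).ncard + ((W ∩ (C ∩ B)).ncard + (W ∩ (D ∩ B)).ncard) := by
      refine (Set.ncard_le_ncard ?_ (Set.toFinite _)).trans ((Set.ncard_union_le _ _).trans
        (add_le_add le_rfl (Set.ncard_union_le _ _)))
      intro x hx
      have h1 := h.sep.1 x
      have h2 := hCD.1 x
      simp only [Set.mem_union, Set.mem_inter_iff]
      tauto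
    omega)
  have hRB : ∀ i, R i ⊆ B := fun i => (hRc i).subset_of_closed (by
    obtain ⟨x, hx, hxR⟩ := hRX i
    exact ⟨x, hxR, (hXZ x hx).2⟩) fun _ _ _ h => h.2.2.1
  obtain ⟨f, hfi, hfR, hfX, -, hfu⟩ := exists_bijective_of_disjoint hRd hRX hXc
  obtain ⟨g, hgi, hgR, hgY, -, hgu⟩ := exists_bijective_of_disjoint hRd hRY hYc
  choose a ha haf using hfX
  choose b hb hbg using hgY
  have hfg : ∀ i, f i ≠ g i := by
    intro i he
    rw [← haf i, ← hbg i] at he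
    have h1 := ha i
    have h2 := hb i
    simp only [Set.mem_Iio, Set.mem_Ico] at h1 h2
    have := h.root_inj (by omega) h2.2 he
    omega
  have hint : ∀ i, ∃ K, Conn H K ∧ K ⊆ R i \ {f i, g i} ∧ (∃ a ∈ K, H.Adj (f i) a) ∧
      ∃ b ∈ K, H.Adj b (g i) := fun i =>
    (hRc i).exists_interior (hfR i) (hgR i) (hfg i) fun hadj => hadj.2.2.2
      ⟨haf i ▸ (hXZ _ ⟨a i, ha i, rfl⟩).1, hbg i ▸ (hYZ _ ⟨b i, hb i, rfl⟩).1⟩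
  choose K hKc hKR hKf hKg using hint
  have hKA : ∀ i, K i ⊆ Aᶜ := by
    intro i x hx hxA
    have hxR := hKR i hx
    rcases hXY x hxA (hRB i hxR.1) with hxX | hxY
    · exact hxR.2 (Or.inl (hfu i x hxX hxR.1))
    · exact hxR.2 (Or.inr (hgu i x hxY hxR.1))
  obtain ⟨L, hKL, hLc, hLd, hLC⟩ := exists_partition_extension hC (⟨0, hn⟩ : Fin n) _ K le_rfl
    (fun i => (hKc i).mono fun _ _ _ _ h => h.1)
    (fun i j hij => (hRd i j hij).mono ((hKR i).trans Set.sdiff_subset)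
      ((hKR j).trans Set.sdiff_subset)) hKA
  have hlt : ∀ i, a i < 2 * n := fun i => by
    have := ha i
    simp only [Set.mem_Iio] at this
    omega
  have : Nonempty (Fin n) := ⟨⟨0, hn⟩⟩
  refine ⟨M, L, a, b, h.conn, h.disj, h.edge, hLc, hLd, fun i j hj => ?_, ha, fun i i' he => ?_, hb,
    fun i i' he => ?_, fun i => ?_, fun i => ?_, ?_⟩
  · rw [Set.disjoint_left]
    intro x hx hxM
    exact (hLC ▸ Set.mem_iUnion.2 ⟨i, hx⟩ : x ∈ Aᶜ) (h.sub j hj hxM)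
  · exact hfi (by rw [← haf, ← haf, he])
  · exact hgi (by rw [← hbg, ← hbg, he])
  · obtain ⟨c, hc, hadj⟩ := hKf i
    exact ⟨f i, haf i ▸ h.root _ (hlt i), c, hKL i hc, hadj.1⟩
  · obtain ⟨c, hc, hadj⟩ := hKg i
    exact ⟨g i, hbg i ▸ h.root _ (hb i).2, c, hKL i hc, hadj.1.symm⟩
  · exact conn_touch (fun i => (hLc i).1) hLd (hLC ▸ hC)

/-- The ball of radius `r` around `c`. -/
def ball (G : SimpleGraph V) (c : V) : ℕ → Set V
  | 0 => {c}
  | r + 1 => ball G c r ∪ {x | ∃ z ∈ ball G c r, G.Adj x z}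

theorem ball_mono (G : SimpleGraph V) (c : V) : Monotone (ball G c) :=
  monotone_nat_of_le_succ fun _ => Set.subset_union_left

theorem conn_ball (G : SimpleGraph V) (c : V) (r : ℕ) : Conn G (ball G c r) ∧ c ∈ ball G c r := by
  refine ⟨?_, ball_mono G c r.zero_le rfl⟩
  induction r with
  | zero => exact conn_singleton G c
  | succ r ih =>
    refine ⟨⟨c, ball_mono G c (r + 1).zero_le rfl⟩, ?_⟩
    rintro T ⟨a, ha, haT⟩ hc
    have hz : (ball G c r ∩ T).Nonempty := by
      rcases ha with ha | ⟨z, hz, haz⟩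
      · exact ⟨a, ha, haT⟩
      · exact ⟨z, hz, hc a (Or.inr ⟨z, hz, haz⟩) haT z (Or.inl hz) haz⟩
    have hsub := ih.2 T hz fun x hx hxT y hy hxy => hc x (Or.inl hx) hxT y (Or.inl hy) hxy
    rintro x (hx | ⟨z, hz, hxz⟩)
    · exact hsub hx
    · exact hc z (Or.inl hz) (hsub hz) x (Or.inr ⟨z, hz, hxz⟩) hxz.symm

theorem ncard_ball_le [Finite V] {G : SimpleGraph V} {p : ℕ}
    (h : ∀ K, Conn G K → {v | v ∉ K ∧ ∃ z ∈ K, G.Adj v z}.ncard < p) (c : V) (r : ℕ) :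
    (ball G c r).ncard ≤ 1 + r * (p - 1) := by
  induction r with
  | zero => simp [ball]
  | succ r ih =>
    have h1 := h _ (conn_ball G c r).1
    have h2 : ball G c (r + 1) ⊆
        ball G c r ∪ {v | v ∉ ball G c r ∧ ∃ z ∈ ball G c r, G.Adj v z} := by
      rintro x (hx | hx)
      · exact Or.inl hx
      · by_cases hxr : x ∈ ball G c r
        · exact Or.inl hxr
        · exact Or.inr ⟨hxr, hx⟩
    have h3 := (Set.ncard_le_ncard h2 (Set.toFinite _)).trans (Set.ncard_union_le _ _)
    rw [add_mul]
    omega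

theorem getElem_mem_ball {G : SimpleGraph V} {L : List V} (hL : L.IsChain G.Adj) {i d : ℕ}
    (h : i + d < L.length) : L[i] ∈ ball G L[i + d] d := by
  induction d generalizing i with
  | zero => exact rfl
  | succ d ih =>
    refine Or.inr ⟨L[i + 1], ?_, List.isChain_iff_getElem.1 hL i (by omega)⟩
    have := ih (i := i + 1) (by omega)
    simpa only [show i + 1 + d = i + (d + 1) by omega] using this

theorem exists_chain_or_star [Finite V] {G : SimpleGraph V} (hG : Conn G Set.univ) {p ρ : ℕ}
    (hp : p ≤ 2 * ρ + 1) (hcard : 1 + ρ * (p - 1) < Nat.card V) :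
    (∃ L : List V, L.IsChain G.Adj ∧ L.Nodup ∧ L.length = p) ∨
    ∃ K, Conn G K ∧ p ≤ {v | v ∉ K ∧ ∃ z ∈ K, G.Adj v z}.ncard := by
  by_contra hcon
  push Not at hcon
  obtain ⟨hpath, hstar⟩ := hcon
  have hshort : ∀ L : List V, L.IsChain G.Adj → L.Nodup → L.length < p := by
    intro L h1 h2
    by_contra! h
    exact hpath (L.take p) (h1.take p) (h2.sublist (L.take_sublist p)) (by simpa using h)
  obtain ⟨v₀, -⟩ := hG.1
  obtain ⟨m, ⟨Q, hQc, hQn, hQm⟩, hmax⟩ : ∃ m, (∃ L : List V, L.IsChain G.Adj ∧ L.Nodup ∧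
      L.length = m) ∧ ∀ L : List V, L.IsChain G.Adj → L.Nodup → L.length ≤ m := by
    classical
    let P : ℕ → Prop := fun m => ∃ L : List V, L.IsChain G.Adj ∧ L.Nodup ∧ L.length = m
    have hP : P 1 := ⟨[v₀], by simp, by simp, rfl⟩
    have h1 : 1 ≤ p := by
      have := hshort [v₀] (by simp) (by simp)
      simp at this; omega
    refine ⟨Nat.findGreatest P p, Nat.findGreatest_spec h1 hP, fun L hc hn => ?_⟩
    exact Nat.le_findGreatest (hshort L hc hn).le ⟨L, hc, hn, rfl⟩
  have hm0 : 1 ≤ m := by simpa using hmax [v₀] (by simp) (by simp)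
  have hmp : m < p := hQm ▸ hshort Q hQc hQn
  have hh : (m - 1) / 2 < Q.length := by omega
  let c := Q[(m - 1) / 2]
  obtain ⟨u, hu⟩ : ∃ u, u ∉ ball G c ρ := by
    by_contra! h
    have h1 := ncard_ball_le hstar c ρ
    rw [Set.eq_univ_of_forall h, Set.ncard_univ] at h1
    omega
  let T : Set V := {u | ∃ Q₁ a Q₂ l, Q = Q₁ ++ a :: Q₂ ∧ (l ++ [a]).IsChain G.Adj ∧ l.Nodup ∧
    (∀ x ∈ l, x ∉ Q) ∧ (l ++ [a]).head? = some u}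
  have hQT : ∀ a ∈ Q, a ∈ T := by
    intro a ha
    obtain ⟨Q₁, Q₂, h⟩ := List.append_of_mem ha
    exact ⟨Q₁, a, Q₂, [], h, by simp, by simp, by simp, by simp⟩
  have huT : u ∈ T := by
    refine hG.2 T ⟨c, trivial, hQT c (List.getElem_mem _)⟩ ?_ (Set.mem_univ u)
    rintro y - ⟨Q₁, a, Q₂, l, hQ, hc, hn, hlQ, hhd⟩ b - hyb
    by_cases hbQ : b ∈ Q
    · exact hQT b hbQ
    by_cases hbl : b ∈ l
    · obtain ⟨l₁, l₂, rfl⟩ := List.append_of_mem hbl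
      refine ⟨Q₁, a, Q₂, b :: l₂, hQ, ?_, ?_, ?_, by simp⟩
      · rw [List.append_assoc] at hc
        exact hc.right_of_append
      · exact hn.of_append_right
      · intro x hx
        exact hlQ x (List.mem_append_right _ hx)
    · refine ⟨Q₁, a, Q₂, b :: l, hQ, ?_, ?_, ?_, by simp⟩
      · rw [List.cons_append, List.isChain_cons]
        refine ⟨?_, hc⟩
        intro z hz
        rw [hhd] at hz
        obtain rfl : y = z := by simpa using hz
        exact hyb.symm
      · exact List.nodup_cons.2 ⟨hbl, hn⟩
      · rintro x (_ | ⟨_, hx⟩)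
        · exact hbQ
        · exact hlQ x hx
  obtain ⟨Q₁, a, Q₂, l, hQ, hc, hn, hlQ, hhd⟩ := huT
  have hmem : ∀ x, x ∈ Q ↔ x ∈ Q₁ ∨ x = a ∨ x ∈ Q₂ := by simp [hQ]
  have hlen : m = Q₁.length + Q₂.length + 1 := by
    rw [← hQm, hQ]; simp; omega
  have happ : ∀ R : List V, (a :: R).IsChain G.Adj → (a :: R).Nodup → (∀ x ∈ R, x ∈ Q) →
      (l ++ a :: R).IsChain G.Adj ∧ l.length + R.length + 1 ≤ m := by
    intro R hRc hRn hRQ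
    have h1 : (l ++ a :: R).IsChain G.Adj := by
      rw [List.isChain_append] at hc ⊢
      exact ⟨hc.1, hRc, by simpa using hc.2.2⟩
    refine ⟨h1, ?_⟩
    have h2 := hmax _ h1 (by
      refine List.Nodup.append hn hRn ?_
      intro x hx hx'
      refine hlQ x hx ?_
      rcases List.mem_cons.1 hx' with rfl | hx'
      · exact (hmem x).2 (by simp)
      · exact hRQ x hx')
    simpa [add_assoc] using h2
  have hdist : ∀ R : List V, (l ++ a :: R).IsChain G.Adj → ∀ (d : ℕ) (hd : d < (a :: R).length),
      l.length + d ≤ ρ → (a :: R)[d] = c → False := by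
    intro R hR d hd hdρ hdc
    have h1 := getElem_mem_ball hR (i := 0) (d := l.length + d)
      (by rw [List.length_append]; omega)
    refine hu (ball_mono G c hdρ ?_)
    have h2 : (l ++ a :: R)[0]'(by simp) = u := by
      cases l with
      | nil => simpa using hhd
      | cons x l => simpa using hhd
    have h3 : (l ++ a :: R)[0 + (l.length + d)]'(by rw [List.length_append]; omega) = c := by
      rw [← hdc, List.getElem_append_right (by omega)]
      congr 1; omega
    rwa [h2, h3] at h1
  have hQ' : Q.reverse = Q₂.reverse ++ a :: Q₁.reverse := by simp [hQ]
  obtain ⟨hc₂, hl₂⟩ := happ Q₂ (hQ ▸ hQc).right_of_append (hQ ▸ hQn).of_append_right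
    (fun x hx => (hmem x).2 (by tauto))
  have hQc' : Q.reverse.IsChain G.Adj := by
    rw [List.isChain_reverse]
    exact hQc.imp fun _ _ h => h.symm
  obtain ⟨hc₁, hl₁⟩ := happ Q₁.reverse (hQ' ▸ hQc').right_of_append
    (hQ' ▸ List.nodup_reverse.2 hQn).of_append_right
    (fun x hx => (hmem x).2 (by simp at hx; tauto))
  rw [List.length_reverse] at hl₁
  rcases le_or_gt Q₁.length ((m - 1) / 2) with hle | hgt
  · refine hdist Q₂ hc₂ ((m - 1) / 2 - Q₁.length) (by simp; omega) (by omega) ?_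
    simp only [c, hQ]
    rw [List.getElem_append_right (by omega)]
  · refine hdist Q₁.reverse hc₁ (Q₁.length - (m - 1) / 2) (by simp) (by omega) ?_
    have h1 : c = Q.reverse[m - 1 - (m - 1) / 2]'(by simp; omega) := by
      rw [List.getElem_reverse]
      simp only [c]
      congr 1; omega
    rw [h1]
    simp only [hQ']
    rw [List.getElem_append_right (by simp; omega)]
    congr 1; simp; omega

theorem Conn.biUnion {G : SimpleGraph V} {ι : Type*} {H : SimpleGraph ι} {S : Set ι}
    {M : ι → Set V} (hS : Conn H S) (hM : ∀ i ∈ S, Conn G (M i))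
    (hadj : ∀ i ∈ S, ∀ j ∈ S, H.Adj i j → ∃ x ∈ M i, ∃ y ∈ M j, G.Adj x y) :
    Conn G (⋃ i ∈ S, M i) := by
  obtain ⟨⟨i₀, hi₀⟩, hS⟩ := hS
  obtain ⟨x₀, hx₀⟩ := (hM i₀ hi₀).1
  refine ⟨⟨x₀, Set.mem_biUnion hi₀ hx₀⟩, ?_⟩
  rintro T ⟨x, hx, hxT⟩ hc
  obtain ⟨i, hi, hxi⟩ := Set.mem_iUnion₂.1 hx
  have hsub : ∀ j ∈ S, (M j ∩ T).Nonempty → M j ⊆ T := fun j hj hne =>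
    (hM j hj).2 T hne fun a ha haT b hb hab =>
      hc a (Set.mem_biUnion hj ha) haT b (Set.mem_biUnion hj hb) hab
  have := hS {j | M j ⊆ T} ⟨i, hi, hsub i hi ⟨x, hxi, hxT⟩⟩ (by
    intro a ha haT b hb hab
    obtain ⟨y, hy, z, hz, hyz⟩ := hadj a ha b hb hab
    exact hsub b hb ⟨z, hz, hc y (Set.mem_biUnion ha hy) (haT hy) z (Set.mem_biUnion hb hz) hyz⟩)
  exact Set.iUnion₂_subset this

theorem conn_biUnion_of_parent {G : SimpleGraph V} {S : Set ℕ} {M : ℕ → Set V} {r : ℕ}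
    (hr : r ∈ S) (hM : ∀ j ∈ S, Conn G (M j))
    (hpar : ∀ j ∈ S, j ≠ r → ∃ i ∈ S, i < j ∧ ∃ x ∈ M j, ∃ y ∈ M i, G.Adj x y) :
    Conn G (⋃ j ∈ S, M j) := by
  refine Conn.biUnion (H := touch G M) ?_ hM fun i _ j _ h => h.2
  have hup : ∀ T : Set ℕ,
      (∀ a ∈ S, a ∈ T → ∀ b ∈ S, (touch G M).Adj a b → b ∈ T) →
      ∀ j ∈ S, (j ∈ T ↔ r ∈ T) := by
    intro T hc j
    induction j using Nat.strong_induction_on with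
    | _ j ih =>
      intro hj
      by_cases hjr : j = r
      · rw [hjr]
      obtain ⟨i, hi, hij, h⟩ := hpar j hj hjr
      have hadj : (touch G M).Adj j i := ⟨hij.ne', h⟩
      rw [← ih i hij hi]
      exact ⟨fun h => hc j hj h i hi hadj, fun h => hc i hi h j hj hadj.symm⟩
  exact ⟨⟨r, hr⟩, fun T ⟨j, hj, hjT⟩ hc i hi =>
    (hup T hc i hi).2 ((hup T hc j hj).1 hjT)⟩

theorem exists_increasing (S : Finset ℕ) {p : ℕ} (hp : p ≤ S.card) :
    ∃ σ : ℕ → ℕ, (∀ i < p, σ i ∈ S) ∧ (∀ i j, i < j → j < p → σ i < σ j) ∧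
      ∀ x ∈ S, σ 0 ≤ x := by
  have hf : (Set.ofPred (· ∈ S)).Finite := S.finite_toSet
  have hcard : hf.toFinset = S := by
    ext x; rw [hf.mem_toFinset]; rfl
  refine ⟨Nat.nth (· ∈ S), fun i hi => ?_, fun i j hij hj => ?_, fun x hx => ?_⟩
  · exact Nat.nth_mem_of_lt_card hf (by rw [hcard]; omega)
  · exact Nat.nth_lt_nth_of_lt_card hf hij (by rw [hcard]; omega)
  · rw [Nat.nth_zero]
    exact Nat.sInf_le hx

/-- A sequence of `p` disjoint connected sets, consecutive ones touching, all touching the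
connected set `H`, with `L t` touching `M (m t)`. -/
structure Strip (G : SimpleGraph V) (n p : ℕ) (M L : ℕ → Set V) (H : Set V) (m : ℕ → ℕ) :
    Prop where
  conn : ∀ t < p, Conn G (L t)
  eq_of_mem : ∀ t < p, ∀ t' < p, ∀ x, x ∈ L t → x ∈ L t' → t = t'
  adj_succ : ∀ t, t + 1 < p → ∃ x ∈ L t, ∃ y ∈ L (t + 1), G.Adj x y
  conn_hub : Conn G H
  notMem_hub : ∀ t < p, ∀ x ∈ L t, x ∉ H
  adj_hub : ∀ t < p, ∃ x ∈ L t, ∃ y ∈ H, G.Adj x y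
  lt : ∀ t < p, m t < n
  inj : ∀ t < p, ∀ t' < p, m t = m t' → t = t'
  adj_mark : ∀ t < p, ∃ x ∈ M (m t), ∃ y ∈ L t, G.Adj x y
  notMem : ∀ j < n, ∀ x ∈ M j, (∀ t < p, x ∉ L t) ∧ x ∉ H

theorem exists_strip {G : SimpleGraph V} {n p ρ : ℕ} (hn : 0 < n) (hp : p ≤ 2 * ρ + 1)
    (hcard : 1 + ρ * (p - 1) < n) {M : ℕ → Set V} {K : Fin n → Set V} {a b : Fin n → ℕ}
    (hM : ∀ j < 2 * n, Conn G (M j))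
    (hMd : ∀ j < 2 * n, ∀ j' < 2 * n, j ≠ j' → Disjoint (M j) (M j'))
    (hMp : ∀ j, n < j → j < 2 * n → ∃ x ∈ M j, ∃ y ∈ M (j - 1), G.Adj x y)
    (hK : ∀ i, Conn G (K i)) (hKd : ∀ i i', i ≠ i' → Disjoint (K i) (K i'))
    (hKM : ∀ i, ∀ j < 2 * n, Disjoint (K i) (M j))
    (ha : ∀ i, a i < n) (hai : Function.Injective a)
    (hb : ∀ i, n ≤ b i ∧ b i < 2 * n) (hbi : Function.Injective b)
    (haK : ∀ i, ∃ x ∈ M (a i), ∃ y ∈ K i, G.Adj x y)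
    (hbK : ∀ i, ∃ x ∈ M (b i), ∃ y ∈ K i, G.Adj x y)
    (hΓ : Conn (touch G K) Set.univ) :
    ∃ L H m, Strip G n p M L H m := by
  have : NeZero n := ⟨hn.ne'⟩
  have hMe : ∀ j < 2 * n, ∀ j' < 2 * n, ∀ x, x ∈ M j → x ∈ M j' → j = j' := by
    intro j hj j' hj' x hx hx'
    by_contra hne
    exact Set.disjoint_left.1 (hMd j hj j' hj' hne) hx hx'
  have hKe : ∀ i i' x, x ∈ K i → x ∈ K i' → i = i' := by
    intro i i' x hx hx'
    by_contra hne
    exact Set.disjoint_left.1 (hKd i i' hne) hx hx'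
  have hKMe : ∀ i, ∀ j < 2 * n, ∀ x, x ∈ K i → x ∉ M j :=
    fun i j hj x hx => Set.disjoint_left.1 (hKM i j hj) hx
  rcases exists_chain_or_star hΓ hp (by simpa using hcard) with
    ⟨Q, hQc, hQn, hQp⟩ | ⟨K₀, hK₀, hcard₀⟩
  · have hq : ∀ t (ht : t < p), Q.getD t 0 = Q[t]'(hQp ▸ ht) := by
      intro t ht
      rw [List.getD_eq_getElem]
    have hqi : ∀ t < p, ∀ t' < p, Q.getD t 0 = Q.getD t' 0 → t = t' := by
      intro t ht t' ht' h
      rw [hq t ht, hq t' ht'] at h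
      exact (hQn.getElem_inj_iff).1 h
    refine ⟨fun t => K (Q.getD t 0), ⋃ j ∈ Set.Ico n (2 * n), M j, fun t => a (Q.getD t 0),
      fun t _ => hK _, fun t ht t' ht' x hx hx' => hqi t ht t' ht' (hKe _ _ x hx hx'), ?_, ?_,
      ?_, ?_, fun t _ => ha _, fun t ht t' ht' h => hqi t ht t' ht' (hai h),
      fun t _ => haK _, ?_⟩
    · intro t ht
      have h := List.isChain_iff_getElem.1 hQc t (by omega)
      rw [← hq t (by omega), ← hq (t + 1) ht] at h
      exact h.2
    · refine conn_biUnion_of_parent (r := n) ⟨le_rfl, by omega⟩ (fun j hj => hM j hj.2) ?_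
      rintro j ⟨hj, hj2⟩ hjn
      exact ⟨j - 1, ⟨by omega, by omega⟩, by omega, hMp j (by omega) hj2⟩
    · intro t _ x hx hx'
      obtain ⟨j, hj, hxj⟩ := Set.mem_iUnion₂.1 hx'
      exact hKMe _ j hj.2 x hx hxj
    · intro t _
      obtain ⟨x, hx, y, hy, hxy⟩ := hbK (Q.getD t 0)
      exact ⟨y, hy, x, Set.mem_biUnion (hb _) hx, hxy.symm⟩
    · intro j hj x hx
      refine ⟨fun t _ hxt => hKMe _ j (by omega) x hxt hx, fun hx' => ?_⟩
      obtain ⟨j', hj', hxj'⟩ := Set.mem_iUnion₂.1 hx'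
      have := hMe j (by omega) j' hj'.2 x hx hxj'
      have := hj'.1
      omega
  · classical
    let S : Finset ℕ := {i | i ∉ K₀ ∧ ∃ z ∈ K₀, (touch G K).Adj i z}.toFinset.image b
    have hS : p ≤ S.card := by
      rw [Finset.card_image_of_injective _ hbi, ← Set.ncard_eq_toFinset_card']
      exact hcard₀
    obtain ⟨σ, hσS, hσ, -⟩ := exists_increasing S hS
    have hq : ∀ t, ∃ i, t < p → b i = σ t ∧ i ∉ K₀ ∧ ∃ z ∈ K₀, (touch G K).Adj i z := by
      intro t
      by_cases ht : t < p
      · have := hσS t ht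
        simp only [S, Finset.mem_image, Set.mem_toFinset, Set.mem_ofPred_eq] at this
        obtain ⟨i, h1, h2⟩ := this
        exact ⟨i, fun _ => ⟨h2, h1⟩⟩
      · exact ⟨0, fun h => absurd h ht⟩
    choose q hq using hq
    let β : ℕ → ℕ := fun t => if t < p then σ t else 2 * n
    have hβ : ∀ t < p, β t = b (q t) := fun t ht => by simp [β, ht, (hq t ht).1]
    have hβr : ∀ t < p, n ≤ β t ∧ β t < 2 * n := fun t ht => by rw [hβ t ht]; exact hb _
    have hβlt : ∀ t t', t < t' → t' ≤ p → β t < β t' := by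
      intro t t' h h'
      rcases h'.lt_or_eq with h' | rfl
      · simp only [β, h', h.trans h', if_true]
        exact hσ t t' h h'
      · have := (hβr t h).2
        simpa [β, h] using this
    have hβp : ∀ t ≤ p, β t ≤ 2 * n := by
      intro t ht
      rcases ht.lt_or_eq with h | rfl
      · exact (hβr t h).2.le
      · simp [β]
    have hqi : ∀ t < p, ∀ t' < p, q t = q t' → t = t' := by
      intro t ht t' ht' h
      have h1 := hβ t ht
      have h2 := hβ t' ht'
      rw [h, ← h2] at h1
      rcases lt_trichotomy t t' with h | h | h
      · have := hβlt t t' h ht'.le; omega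
      · exact h
      · have := hβlt t' t h ht.le; omega
    have hIco : ∀ t < p, ∀ j ∈ Set.Ico (β t) (β (t + 1)), n ≤ j ∧ j < 2 * n := by
      rintro t ht j ⟨h1, h2⟩
      have := (hβr t ht).1
      have := hβp (t + 1) (by omega)
      omega
    have hmemL : ∀ t j x, j ∈ Set.Ico (β t) (β (t + 1)) → x ∈ M j →
        x ∈ K (q t) ∪ ⋃ j ∈ Set.Ico (β t) (β (t + 1)), M j :=
      fun t j x hj hx => Or.inr (Set.mem_biUnion hj hx)
    refine ⟨fun t => K (q t) ∪ ⋃ j ∈ Set.Ico (β t) (β (t + 1)), M j, ⋃ i ∈ K₀, K i,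
      fun t => a (q t), ?_, ?_, ?_, hK₀.biUnion (fun i _ => hK i) fun i _ j _ h => h.2, ?_, ?_,
      fun t _ => ha _, fun t ht t' ht' h => hqi t ht t' ht' (hai h), ?_, ?_⟩
    · intro t ht
      obtain ⟨x, hx, y, hy, hxy⟩ := hbK (q t)
      have h1 : β t ∈ Set.Ico (β t) (β (t + 1)) := ⟨le_rfl, hβlt t (t + 1) (by omega) (by omega)⟩
      refine (hK (q t)).union_of_adj (conn_biUnion_of_parent (r := β t) h1
        (fun j hj => hM j (hIco t ht j hj).2) ?_) hy
        (Set.mem_biUnion h1 (by rwa [hβ t ht])) hxy.symm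
      intro j hj hne
      have h2 := hIco t ht j hj
      obtain ⟨h3, h4⟩ := hj
      have := (hβr t ht).1
      exact ⟨j - 1, ⟨by omega, by omega⟩, by omega, hMp j (by omega) h2.2⟩
    · intro t ht t' ht' x hx hx'
      rcases hx with hx | hx <;> rcases hx' with hx' | hx'
      · exact hqi t ht t' ht' (hKe _ _ x hx hx')
      · obtain ⟨j, hj, hxj⟩ := Set.mem_iUnion₂.1 hx'
        exact absurd hxj (hKMe _ j (hIco t' ht' j hj).2 x hx)
      · obtain ⟨j, hj, hxj⟩ := Set.mem_iUnion₂.1 hx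
        exact absurd hxj (hKMe _ j (hIco t ht j hj).2 x hx')
      · obtain ⟨j, hj, hxj⟩ := Set.mem_iUnion₂.1 hx
        obtain ⟨j', hj', hxj'⟩ := Set.mem_iUnion₂.1 hx'
        obtain rfl := hMe j (hIco t ht j hj).2 j' (hIco t' ht' j' hj').2 x hxj hxj'
        have hmono : ∀ t₁ t₂, t₁ ≤ t₂ → t₂ ≤ p → β t₁ ≤ β t₂ := by
          intro t₁ t₂ h h'
          rcases h.lt_or_eq with h | rfl
          · exact (hβlt _ _ h h').le
          · exact le_rfl
        obtain ⟨h1, h2⟩ := hj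
        obtain ⟨h3, h4⟩ := hj'
        rcases lt_trichotomy t t' with h | h | h
        · have := hmono (t + 1) t' h ht'.le; omega
        · exact h
        · have := hmono (t' + 1) t h ht.le; omega
    · intro t ht
      have h1 := hβlt t (t + 1) (by omega) ht.le
      have h2 := hβlt (t + 1) (t + 1 + 1) (by omega) ht
      have h3 := hβr t (by omega)
      have h4 := hβr (t + 1) ht
      obtain ⟨x, hx, y, hy, hxy⟩ := hMp (β (t + 1)) (by omega) h4.2
      exact ⟨y, hmemL t _ y ⟨by omega, by omega⟩ hy, x, hmemL (t + 1) _ x ⟨le_rfl, h2⟩ hx,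
        hxy.symm⟩
    · intro t ht x hx hx'
      obtain ⟨i, hi, hxi⟩ := Set.mem_iUnion₂.1 hx'
      rcases hx with hx | hx
      · exact (hq t ht).2.1 (hKe _ _ x hxi hx ▸ hi)
      · obtain ⟨j, hj, hxj⟩ := Set.mem_iUnion₂.1 hx
        exact hKMe i j (hIco t ht j hj).2 x hxi hxj
    · intro t ht
      obtain ⟨-, -, z, hz, -, x, hx, y, hy, hxy⟩ := hq t ht
      exact ⟨x, Or.inl hx, y, Set.mem_biUnion hz hy, hxy⟩
    · intro t ht
      obtain ⟨x, hx, y, hy, hxy⟩ := haK (q t)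
      exact ⟨x, hx, y, Or.inl hy, hxy⟩
    · intro j hj x hx
      refine ⟨?_, fun hx' => ?_⟩
      · rintro t ht (hxt | hxt)
        · exact hKMe _ j (by omega) x hxt hx
        · obtain ⟨j', hj', hxj'⟩ := Set.mem_iUnion₂.1 hxt
          have h1 := hIco t ht j' hj'
          have := hMe j (by omega) j' h1.2 x hx hxj'
          omega
      · obtain ⟨i, hi, hxi⟩ := Set.mem_iUnion₂.1 hx'
        exact hKMe i j (by omega) x hxi hx

theorem isMinor_doubleWheel {G : SimpleGraph V} {r : ℕ} {B : ℕ → Set V} {P Q : Set V}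
    (hB : ∀ i < r, Conn G (B i)) (hP : Conn G P) (hQ : Conn G Q)
    (hBB : ∀ i < r, ∀ j < r, i ≠ j → Disjoint (B i) (B j))
    (hBP : ∀ i < r, Disjoint (B i) P) (hBQ : ∀ i < r, Disjoint (B i) Q) (hPQ : Disjoint P Q)
    (hsucc : ∀ i, i + 1 < r → ∃ x ∈ B i, ∃ y ∈ B (i + 1), G.Adj x y)
    (hlast : ∃ x ∈ B (r - 1), ∃ y ∈ B 0, G.Adj x y)
    (hadjP : ∀ i < r, ∃ x ∈ B i, ∃ y ∈ P, G.Adj x y)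
    (hadjQ : ∀ i < r, ∃ x ∈ B i, ∃ y ∈ Q, G.Adj x y) :
    IsMinor (doubleWheel r) G := by
  refine ⟨Sum.elim (fun i => B i) ![P, Q], ?_, ?_, ?_⟩
  · rintro (i | i)
    · exact (hB i i.2).induce_connected
    · fin_cases i
      · exact hP.induce_connected
      · exact hQ.induce_connected
  · rintro (i | i) (j | j) hij
    · exact hBB i i.2 j j.2 fun h => hij (by rw [Fin.ext h])
    · fin_cases j
      · exact hBP i i.2
      · exact hBQ i i.2
    · fin_cases i
      · exact (hBP j j.2).symm
      · exact (hBQ j j.2).symm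
    · fin_cases i <;> fin_cases j
      · exact absurd rfl hij
      · exact hPQ
      · exact hPQ.symm
      · exact absurd rfl hij
  · have hrel : ∀ u v : Fin r ⊕ Fin 2, (match u, v with
        | Sum.inl i, Sum.inl j => (j : ℕ) = ((i : ℕ) + 1) % r
        | Sum.inl _, Sum.inr _ => True
        | _, _ => False) → ∃ x ∈ Sum.elim (fun i : Fin r => B i) ![P, Q] u,
          ∃ y ∈ Sum.elim (fun i : Fin r => B i) ![P, Q] v, G.Adj x y := by
      rintro (i | i) (j | j) h
      · simp only at h
        simp only [Sum.elim_inl, h]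
        rcases Nat.lt_or_ge (i + 1) r with hi | hi
        · rw [Nat.mod_eq_of_lt hi]
          exact hsucc i hi
        · have hi' : (i : ℕ) + 1 = r := by omega
          rw [hi', Nat.mod_self, show (i : ℕ) = r - 1 by omega]
          exact hlast
      · fin_cases j
        · exact hadjP i i.2
        · exact hadjQ i i.2
      · exact h.elim
      · exact h.elim
    rintro u v ⟨-, h | h⟩
    · exact hrel u v h
    · obtain ⟨x, hx, y, hy, hxy⟩ := hrel v u h
      exact ⟨y, hy, x, hx, hxy.symm⟩

theorem Strip.isMinor_doubleWheel {G : SimpleGraph V} {n p κ : ℕ} {M L : ℕ → Set V} {H : Set V}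
    {m : ℕ → ℕ} (h : Strip G n p M L H m) (hκ : 0 < κ)
    (hMd : ∀ j < n, ∀ j' < n, j ≠ j' → Disjoint (M j) (M j')) {I J : Finset ℕ}
    (hI : ∀ j ∈ I, j < n) (hJ : ∀ j ∈ J, j < n) (hIJ : Disjoint I J)
    (hIc : Conn G (⋃ j ∈ I, M j)) (hJc : Conn G (⋃ j ∈ J, M j))
    (hadj : ∃ x ∈ ⋃ j ∈ I, M j, ∃ y ∈ ⋃ j ∈ J, M j, G.Adj x y)
    (hfirst : m 0 ∈ J) (hlast : m (p - 1) ∈ J)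
    (hcard : κ ≤ ((Finset.range p).filter (m · ∈ I)).card) :
    IsMinor (doubleWheel (κ + 1)) G := by
  have hnot : ∀ j ∈ I, j ∉ J := fun j hj => Finset.disjoint_left.1 hIJ hj
  obtain ⟨σ', hσS, hσlt, hσ0⟩ := exists_increasing (p := κ + 1)
    (insert 0 ((Finset.range p).filter (m · ∈ I))) (by
      rw [Finset.card_insert_of_notMem]
      · omega
      · simp only [Finset.mem_filter, not_and]
        exact fun _ h0 => hnot _ h0 hfirst)
  have hσ0 : σ' 0 = 0 := by simpa using hσ0 0 (by simp)
  have hσI : ∀ i, 0 < i → i ≤ κ → σ' i < p - 1 ∧ m (σ' i) ∈ I := by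
    intro i hi hiκ
    have h1 := hσS i (by omega)
    have h2 := hσlt 0 i hi (by omega)
    rw [Finset.mem_insert, Finset.mem_filter, Finset.mem_range] at h1
    obtain ⟨h3, h4⟩ := h1.resolve_left (by omega)
    have : σ' i ≠ p - 1 := fun h => hnot _ h4 (h ▸ hlast)
    exact ⟨by omega, h4⟩
  have hp : 1 < p := by
    have := hσI 1 one_pos hκ
    omega
  let σ : ℕ → ℕ := fun i => if i ≤ κ then σ' i else p - 1
  have hσs : ∀ i ≤ κ, σ i < σ (i + 1) := by
    intro i hi
    rcases hi.lt_or_eq with hi' | rfl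
    · simp only [σ, hi, show i + 1 ≤ κ from hi', if_true]
      exact hσlt i (i + 1) (by omega) (by omega)
    · simpa [σ] using (hσI i hκ le_rfl).1
  have hσlast : σ (κ + 1) = p - 1 := by simp [σ]
  have hσfirst : σ 0 = 0 := by simpa [σ] using hσ0
  have hσm : ∀ i, 0 < i → i ≤ κ → m (σ i) ∈ I := fun i hi hiκ => by
    simpa [σ, hiκ] using (hσI i hi hiκ).2
  have hmono : ∀ j ≤ κ + 1, ∀ i ≤ j, σ i ≤ σ j := by
    intro j
    induction j with
    | zero => intro _ i hi; rw [Nat.le_zero.1 hi]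
    | succ j ih =>
      intro hj i hi
      rcases hi.lt_or_eq with hi | rfl
      · exact (ih (by omega) i (by omega)).trans (hσs j (by omega)).le
      · exact le_rfl
  have hlt : ∀ i ≤ κ, ∀ t, t < σ (i + 1) → t < p - 1 := by
    intro i hi t ht
    have := hmono (κ + 1) le_rfl (i + 1) (by omega)
    omega
  clear_value σ
  have hML : ∀ S : Finset ℕ, (∀ j ∈ S, j < n) → ∀ x ∈ ⋃ j ∈ S, M j,
      (∀ t < p, x ∉ L t) ∧ x ∉ H := by
    intro S hS x hx
    obtain ⟨j, hj, hxj⟩ := Set.mem_iUnion₂.1 hx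
    exact h.notMem j (hS j hj) x hxj
  have hMM : ∀ x ∈ ⋃ j ∈ I, M j, x ∉ ⋃ j ∈ J, M j := by
    intro x hx hx'
    obtain ⟨j, hj, hxj⟩ := Set.mem_iUnion₂.1 hx
    obtain ⟨j', hj', hxj'⟩ := Set.mem_iUnion₂.1 hx'
    by_cases hne : j = j'
    · exact hnot j hj (hne ▸ hj')
    · exact Set.disjoint_left.1 (hMd j (hI j hj) j' (hJ j' hj') hne) hxj hxj'
  let B : ℕ → Set V := fun i => (⋃ t ∈ Set.Ico (σ i) (σ (i + 1)), L t) ∪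
    {x | i = 0 ∧ x ∈ (⋃ j ∈ J, M j) ∪ L (p - 1)}
  have hLB : ∀ i t x, σ i ≤ t → t < σ (i + 1) → x ∈ L t → x ∈ B i :=
    fun i t x h1 h2 hx => Or.inl (Set.mem_biUnion (show t ∈ Set.Ico _ _ from ⟨h1, h2⟩) hx)
  have hBcases : ∀ i ≤ κ, ∀ x ∈ B i, (∃ t < p - 1, σ i ≤ t ∧ t < σ (i + 1) ∧ x ∈ L t) ∨
      i = 0 ∧ (x ∈ (⋃ j ∈ J, M j) ∨ x ∈ L (p - 1)) := by
    rintro i hi x (hx | hx)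
    · obtain ⟨t, ht, hxt⟩ := Set.mem_iUnion₂.1 hx
      exact Or.inl ⟨t, hlt i hi t ht.2, ht.1, ht.2, hxt⟩
    · exact Or.inr hx
  have hconn : ∀ i ≤ κ, Conn G (⋃ t ∈ Set.Ico (σ i) (σ (i + 1)), L t) := by
    intro i hi
    refine conn_biUnion_of_parent (r := σ i) ⟨le_rfl, hσs i hi⟩
      (fun t ht => h.conn t (by have := hlt i hi t ht.2; omega)) ?_
    rintro t ⟨ht1, ht2⟩ hne
    have := hlt i hi t ht2
    obtain ⟨x, hx, y, hy, hxy⟩ := h.adj_succ (t - 1) (by omega)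
    rw [show t - 1 + 1 = t by omega] at hy
    exact ⟨t - 1, ⟨by omega, by omega⟩, by omega, y, hy, x, hx, hxy.symm⟩
  refine GraphConn.isMinor_doubleWheel (B := B) (P := ⋃ j ∈ I, M j) (Q := H) ?_ hIc h.conn_hub
    ?_ ?_ ?_ ?_ ?_ ?_ ?_ ?_
  · intro i hi
    by_cases hi0 : i = 0
    · subst hi0
      obtain ⟨x, hx, y, hy, hxy⟩ := h.adj_mark (p - 1) (by omega)
      have h1 := hJc.union_of_adj (h.conn (p - 1) (by omega)) (Set.mem_biUnion hlast hx) hy hxy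
      obtain ⟨x, hx, y, hy, hxy⟩ := h.adj_mark 0 (by omega)
      have h2 := (hconn 0 (by omega)).union_of_adj h1
        (Set.mem_biUnion (show (0 : ℕ) ∈ Set.Ico (σ 0) (σ (0 + 1)) from
          ⟨hσfirst.le, by have := hσs 0 (by omega); omega⟩) hy)
        (Or.inl (Set.mem_biUnion hfirst hx)) hxy.symm
      convert h2 using 1
      ext x
      simp [B]
    · simpa [B, hi0] using hconn i (by omega)
  · intro i hi i' hi' hne
    rw [Set.disjoint_left]
    intro x hx hx'
    rcases hBcases i (by omega) x hx with ⟨t, htp, ht1, ht2, hxt⟩ | ⟨rfl, hxJ⟩ <;>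
      rcases hBcases i' (by omega) x hx' with ⟨t', htp', ht1', ht2', hxt'⟩ | ⟨rfl, hxJ'⟩
    · obtain rfl := h.eq_of_mem t (by omega) t' (by omega) x hxt hxt'
      rcases lt_trichotomy i i' with hlt | hlt | hlt
      · have := hmono i' (by omega) (i + 1) hlt; omega
      · exact hne hlt
      · have := hmono i (by omega) (i' + 1) hlt; omega
    · rcases hxJ' with hxJ' | hxJ'
      · exact (hML J hJ x hxJ').1 t (by omega) hxt
      · have := h.eq_of_mem t (by omega) (p - 1) (by omega) x hxt hxJ'
        omega
    · rcases hxJ with hxJ | hxJ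
      · exact (hML J hJ x hxJ).1 t' (by omega) hxt'
      · have := h.eq_of_mem t' (by omega) (p - 1) (by omega) x hxt' hxJ
        omega
    · exact hne rfl
  · intro i hi
    rw [Set.disjoint_left]
    intro x hx hxI
    rcases hBcases i (by omega) x hx with ⟨t, htp, -, -, hxt⟩ | ⟨-, hxJ | hxp⟩
    · exact (hML I hI x hxI).1 t (by omega) hxt
    · exact hMM x hxI hxJ
    · exact (hML I hI x hxI).1 (p - 1) (by omega) hxp
  · intro i hi
    rw [Set.disjoint_left]
    intro x hx hxH
    rcases hBcases i (by omega) x hx with ⟨t, htp, -, -, hxt⟩ | ⟨-, hxJ | hxp⟩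
    · exact h.notMem_hub t (by omega) x hxt hxH
    · exact (hML J hJ x hxJ).2 hxH
    · exact h.notMem_hub (p - 1) (by omega) x hxp hxH
  · rw [Set.disjoint_left]
    exact fun x hx => (hML I hI x hx).2
  · intro i hi
    have h1 := hσs i (by omega)
    have h2 := hσs (i + 1) (by omega)
    have h3 := hmono (κ + 1) le_rfl (i + 1) (by omega)
    obtain ⟨x, hx, y, hy, hxy⟩ := h.adj_succ (σ (i + 1) - 1) (by omega)
    rw [show σ (i + 1) - 1 + 1 = σ (i + 1) by omega] at hy
    exact ⟨x, hLB i _ x (by omega) (by omega) hx, y, hLB (i + 1) _ y le_rfl h2 hy, hxy⟩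
  · have h1 := hσs κ le_rfl
    obtain ⟨x, hx, y, hy, hxy⟩ := h.adj_succ (p - 1 - 1) (by omega)
    rw [show p - 1 - 1 + 1 = p - 1 by omega] at hy
    exact ⟨x, hLB κ _ x (by omega) (by omega) hx, y, Or.inr ⟨rfl, Or.inr hy⟩, hxy⟩
  · intro i hi
    by_cases hi0 : i = 0
    · subst hi0
      obtain ⟨x, hx, y, hy, hxy⟩ := hadj
      exact ⟨y, Or.inr ⟨rfl, Or.inl hy⟩, x, hx, hxy.symm⟩
    · have h1 := hσs i (by omega)
      have h3 := hlt i (by omega) (σ i) h1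
      obtain ⟨x, hx, y, hy, hxy⟩ := h.adj_mark (σ i) (by omega)
      exact ⟨y, hLB i _ y le_rfl h1 hy, x,
        Set.mem_biUnion (hσm i (by omega) (by omega)) hx, hxy.symm⟩
  · intro i hi
    have h1 := hσs i (by omega)
    have h3 := hlt i (by omega) (σ i) h1
    obtain ⟨x, hx, y, hy, hxy⟩ := h.adj_hub (σ i) (by omega)
    exact ⟨x, hLB i _ x le_rfl h1 hx, y, hy, hxy⟩

/-- `w` lies in the subtree rooted at `u` of the binary heap on the positive integers, in which
the parent of `w` is `w / 2`. -/
def HeapBelow (u w : ℕ) : Prop :=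
  ∃ e, w / 2 ^ e = u

namespace HeapBelow

theorem refl (u : ℕ) : HeapBelow u u :=
  ⟨0, by simp⟩

theorem le {u w : ℕ} (h : HeapBelow u w) : u ≤ w := by
  obtain ⟨e, rfl⟩ := h
  exact Nat.div_le_self _ _

theorem trans {u v w : ℕ} (huv : HeapBelow u v) (hvw : HeapBelow v w) : HeapBelow u w := by
  obtain ⟨e, rfl⟩ := huv
  obtain ⟨e', rfl⟩ := hvw
  exact ⟨e' + e, by rw [pow_add, Nat.div_div_eq_div_mul]⟩

theorem of_half {u w : ℕ} (h : HeapBelow u (w / 2)) : HeapBelow u w :=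
  h.trans ⟨1, by simp⟩

theorem two_mul (u : ℕ) : HeapBelow u (2 * u) :=
  ⟨1, by omega⟩

theorem two_mul_add_one (u : ℕ) : HeapBelow u (2 * u + 1) :=
  ⟨1, by omega⟩

theorem half {u w : ℕ} (h : HeapBelow u w) (hne : w ≠ u) : HeapBelow u (w / 2) := by
  obtain ⟨_ | e, h⟩ := h
  · simp at h; omega
  · exact ⟨e, by rw [Nat.div_div_eq_div_mul, ← pow_succ', h]⟩

theorem cases {u w : ℕ} (h : HeapBelow u w) :
    w = u ∨ HeapBelow (2 * u) w ∨ HeapBelow (2 * u + 1) w := by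
  obtain ⟨_ | e, h⟩ := h
  · simp at h; exact Or.inl h
  · rw [pow_succ, ← Nat.div_div_eq_div_mul] at h
    right
    rcases Nat.mod_two_eq_zero_or_one (w / 2 ^ e) with h' | h'
    · exact Or.inl ⟨e, by omega⟩
    · exact Or.inr ⟨e, by omega⟩

theorem total {u v w : ℕ} (hu : HeapBelow u w) (hv : HeapBelow v w) :
    HeapBelow u v ∨ HeapBelow v u := by
  obtain ⟨e, rfl⟩ := hu
  obtain ⟨e', rfl⟩ := hv
  rcases le_total e e' with h | h
  · exact Or.inr ⟨e' - e, by rw [Nat.div_div_eq_div_mul, ← pow_add, Nat.add_sub_cancel' h]⟩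
  · exact Or.inl ⟨e - e', by rw [Nat.div_div_eq_div_mul, ← pow_add, Nat.add_sub_cancel' h]⟩

theorem not_both {u w : ℕ} (hu : 0 < u) (h : HeapBelow (2 * u) w) :
    ¬ HeapBelow (2 * u + 1) w := by
  intro h'
  rcases h.total h' with h | h
  · have := (h.half (by omega)).le
    omega
  · have := h.le
    omega

theorem one {w : ℕ} (hw : 0 < w) : HeapBelow 1 w := by
  induction w using Nat.strong_induction_on with
  | _ w ih =>
    by_cases h1 : w = 1
    · rw [h1]; exact refl 1
    · exact of_half (ih (w / 2) (by omega) (by omega))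

end HeapBelow

open Classical in
theorem card_heapBelow_le (A : Finset ℕ) (u : ℕ) :
    (A.filter (HeapBelow u)).card ≤
      1 + (A.filter (HeapBelow (2 * u))).card + (A.filter (HeapBelow (2 * u + 1))).card := by
  have hsub : A.filter (HeapBelow u) ⊆
      ({u} ∪ A.filter (HeapBelow (2 * u))) ∪ A.filter (HeapBelow (2 * u + 1)) := by
    intro w hw
    simp only [Finset.mem_filter, Finset.mem_union, Finset.mem_singleton] at hw ⊢
    have := hw.2.cases
    tauto
  have h1 := Finset.card_le_card hsub
  have h2 := Finset.card_union_le ({u} ∪ A.filter (HeapBelow (2 * u)))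
    (A.filter (HeapBelow (2 * u + 1)))
  have h3 := Finset.card_union_le {u} (A.filter (HeapBelow (2 * u)))
  rw [Finset.card_singleton] at h3
  omega

open Classical in
theorem exists_branching {A : Finset ℕ} {n κ : ℕ} (hA : ∀ w ∈ A, w ≤ n) :
    ∀ (h u : ℕ), n < u * 2 ^ h → κ * h < (A.filter (HeapBelow u)).card →
      ∃ v, HeapBelow u v ∧ κ ≤ (A.filter (HeapBelow (2 * v))).card ∧
        κ ≤ (A.filter (HeapBelow (2 * v + 1))).card := by
  intro h
  induction h with
  | zero =>
    intro u hu hc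
    obtain ⟨w, hw⟩ := Finset.card_pos.1 (Nat.zero_lt_of_lt hc)
    rw [Finset.mem_filter] at hw
    have := hA w hw.1
    have := hw.2.le
    omega
  | succ h ih =>
    intro u hu hc
    have hle := card_heapBelow_le A u
    rw [Nat.mul_succ] at hc
    have hu' : u * 2 ^ (h + 1) = 2 * u * 2 ^ h := by ring
    by_cases h1 : κ ≤ (A.filter (HeapBelow (2 * u))).card
    · by_cases h2 : κ ≤ (A.filter (HeapBelow (2 * u + 1))).card
      · exact ⟨u, HeapBelow.refl u, h1, h2⟩
      · obtain ⟨v, hv, h⟩ := ih (2 * u) (by omega) (by omega)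
        exact ⟨v, (HeapBelow.two_mul u).trans hv, h⟩
    · obtain ⟨v, hv, h⟩ := ih (2 * u + 1) (by rw [add_mul]; omega) (by omega)
      exact ⟨v, (HeapBelow.two_mul_add_one u).trans hv, h⟩

open Classical in
theorem exists_heap_cut {A : Finset ℕ} {n d κ f l : ℕ} (hA : ∀ w ∈ A, 0 < w ∧ w ≤ n)
    (hκ : 0 < κ) (hn : n < 2 ^ (d + 1)) (hcard : κ * (2 * d + 1) < A.card)
    (hf : f ∈ A) :
    ∃ x, 1 < x ∧ x ≤ n ∧
      (¬ HeapBelow x f ∧ ¬ HeapBelow x l ∧ κ ≤ (A.filter (HeapBelow x)).card ∨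
        HeapBelow x f ∧ HeapBelow x l ∧ κ ≤ (A.filter (¬ HeapBelow x ·)).card) := by
  have hsplit : ∀ v, (A.filter (HeapBelow v)).card + (A.filter (¬ HeapBelow v ·)).card = A.card :=
    fun v => Finset.card_filter_add_card_filter_not _
  have h1 : A.filter (HeapBelow 1) = A :=
    Finset.filter_true_of_mem fun w hw => HeapBelow.one (hA w hw).1
  have hpos : ∀ v, 0 < (A.filter (HeapBelow v)).card → v ≤ n := by
    intro v hv
    obtain ⟨w, hw⟩ := Finset.card_pos.1 hv
    rw [Finset.mem_filter] at hw
    exact hw.2.le.trans (hA w hw.1).2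
  let P : ℕ → Prop := fun v => A.card < (A.filter (HeapBelow v)).card + κ
  have hP1 : P 1 := by simp only [P, h1]; omega
  have hκA : κ < A.card := lt_of_le_of_lt (Nat.le_mul_of_pos_right κ (by omega)) hcard
  have hPn : ∀ v, P v → v ≤ n := fun v hv => hpos v (by simp only [P] at hv; omega)
  let v := Nat.findGreatest P n
  have hPv : P v := Nat.findGreatest_spec (hPn 1 hP1) hP1
  have hmax : ∀ u, v < u → ¬ P u := fun u hu hPu =>
    Nat.findGreatest_is_greatest hu (hPn u hPu) hPu
  have hv1 : 1 ≤ v := Nat.le_findGreatest (hPn 1 hP1) hP1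
  obtain ⟨u, hu, hu2, hcu⟩ : ∃ u, v < u ∧ 2 ≤ u ∧
      κ * d < (A.filter (HeapBelow u)).card := by
    have hle := card_heapBelow_le A v
    simp only [P] at hPv
    have : κ * (2 * d + 1) = 2 * (κ * d) + κ := by ring
    by_cases hc : κ * d < (A.filter (HeapBelow (2 * v))).card
    · exact ⟨2 * v, by omega, by omega, hc⟩
    · exact ⟨2 * v + 1, by omega, by omega, by omega⟩
  have hnu : n < u * 2 ^ d := by
    have := Nat.mul_le_mul_right (2 ^ d) hu2
    rw [pow_succ] at hn
    omega
  obtain ⟨w, huw, hw1, hw2⟩ := exists_branching (fun w hw => (hA w hw).2) d u hnu hcu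
  have hw3 : κ ≤ (A.filter (¬ HeapBelow w ·)).card := by
    have h2 := hmax u hu
    have h3 := hsplit u
    have h4 : (A.filter (¬ HeapBelow u ·)).card ≤ (A.filter (¬ HeapBelow w ·)).card := by
      refine Finset.card_le_card fun x hx => ?_
      rw [Finset.mem_filter] at hx ⊢
      exact ⟨hx.1, fun h => hx.2 (huw.trans h)⟩
    simp only [P] at h2
    omega
  have hw0 := huw.le
  by_cases hl1 : ¬ HeapBelow (2 * w) f ∧ ¬ HeapBelow (2 * w) l
  · exact ⟨2 * w, by omega, hpos _ (by omega), Or.inl ⟨hl1.1, hl1.2, hw1⟩⟩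
  by_cases hl2 : ¬ HeapBelow (2 * w + 1) f ∧ ¬ HeapBelow (2 * w + 1) l
  · exact ⟨2 * w + 1, by omega, hpos _ (by omega), Or.inl ⟨hl2.1, hl2.2, hw2⟩⟩
  have hf2 := HeapBelow.not_both (u := w) (w := f) (by omega)
  have hl2 := HeapBelow.not_both (u := w) (w := l) (by omega)
  have hup : ∀ y, HeapBelow (2 * w) y ∨ HeapBelow (2 * w + 1) y → HeapBelow w y := by
    rintro y (h | h)
    · exact (HeapBelow.two_mul w).trans h
    · exact (HeapBelow.two_mul_add_one w).trans h
  have hwf : HeapBelow w f := hup f (by tauto)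
  exact ⟨w, by omega, hwf.le.trans (hA f hf).2, Or.inr ⟨hwf, hup l (by tauto), hw3⟩⟩

theorem Strip.isMinor_of_heap {G : SimpleGraph V} {n d κ : ℕ} {M L : ℕ → Set V} {H : Set V}
    {m : ℕ → ℕ} (h : Strip G n (κ * (2 * d + 1) + 1) M L H m) (hκ : 0 < κ)
    (hn : n < 2 ^ (d + 1)) (hM : ∀ j < n, Conn G (M j))
    (hMd : ∀ j < n, ∀ j' < n, j ≠ j' → Disjoint (M j) (M j'))
    (hMp : ∀ j, 0 < j → j < n → ∃ x ∈ M j, ∃ y ∈ M ((j + 1) / 2 - 1), G.Adj x y) :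
    IsMinor (doubleWheel (κ + 1)) G := by
  classical
  set p := κ * (2 * d + 1) + 1 with hp
  have hA : ∀ w ∈ (Finset.range p).image (fun t => m t + 1), 0 < w ∧ w ≤ n := by
    intro w hw
    obtain ⟨t, ht, rfl⟩ := Finset.mem_image.1 hw
    have := h.lt t (Finset.mem_range.1 ht)
    omega
  have hcA : ((Finset.range p).image (fun t => m t + 1)).card = p := by
    rw [Finset.card_image_of_injOn, Finset.card_range]
    intro t ht t' ht' htt'
    exact h.inj t (by simpa using ht) t' (by simpa using ht') (by simpa using htt')
  have hfilter : ∀ P : ℕ → Prop, κ ≤ (((Finset.range p).image (fun t => m t + 1)).filter P).card →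
      ∀ S : Finset ℕ, (∀ j < n, P (j + 1) → j ∈ S) →
      κ ≤ ((Finset.range p).filter (m · ∈ S)).card := by
    intro P hP S hS
    rw [Finset.filter_image] at hP
    refine (hP.trans Finset.card_image_le).trans (Finset.card_le_card fun t ht => ?_)
    rw [Finset.mem_filter] at ht ⊢
    exact ⟨ht.1, hS _ (h.lt t (Finset.mem_range.1 ht.1)) ht.2⟩
  have hm0 := h.lt 0 (by omega)
  have hm1 := h.lt (p - 1) (by omega)
  obtain ⟨x, hx1, hxn, hx⟩ := exists_heap_cut (f := m 0 + 1) (l := m (p - 1) + 1) hA hκ hn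
    (by rw [hcA]; omega) (Finset.mem_image.2 ⟨0, by simp [hp], rfl⟩)
  let S : Finset ℕ := (Finset.range n).filter fun j => HeapBelow x (j + 1)
  let T : Finset ℕ := (Finset.range n).filter fun j => ¬ HeapBelow x (j + 1)
  have hSn : ∀ j ∈ S, j < n := fun j hj => by simpa using (Finset.mem_filter.1 hj).1
  have hTn : ∀ j ∈ T, j < n := fun j hj => by simpa using (Finset.mem_filter.1 hj).1
  have hmemS : ∀ j < n, HeapBelow x (j + 1) → j ∈ S := fun j hj hjx =>
    Finset.mem_filter.2 ⟨Finset.mem_range.2 hj, hjx⟩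
  have hmemT : ∀ j < n, ¬ HeapBelow x (j + 1) → j ∈ T := fun j hj hjx =>
    Finset.mem_filter.2 ⟨Finset.mem_range.2 hj, hjx⟩
  have hST : Disjoint S T := Finset.disjoint_filter_filter_not _ _ _
  have hxS : x - 1 ∈ S := by
    refine hmemS _ (by omega) ?_
    rw [Nat.sub_add_cancel (by omega)]
    exact HeapBelow.refl x
  have hxT : x / 2 - 1 ∈ T := by
    refine hmemT _ (by omega) fun hle => ?_
    have := hle.le
    omega
  have hSc : Conn G (⋃ j ∈ S, M j) := by
    refine conn_biUnion_of_parent (S := S) (r := x - 1) hxS (fun j hj => hM j (hSn j hj)) ?_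
    intro j hj hne
    have hjn := hSn j hj
    have hjx := ((Finset.mem_filter.1 hj).2.half (by omega))
    have := hjx.le
    refine ⟨(j + 1) / 2 - 1, hmemS _ (by omega) ?_, by omega, hMp j (by omega) hjn⟩
    rwa [Nat.sub_add_cancel (by omega)]
  have hTc : Conn G (⋃ j ∈ T, M j) := by
    refine conn_biUnion_of_parent (S := T) (r := 0) (hmemT 0 (by omega) fun hle => ?_)
      (fun j hj => hM j (hTn j hj)) ?_
    · have := hle.le
      omega
    intro j hj hne
    have hjn := hTn j hj
    refine ⟨(j + 1) / 2 - 1, hmemT _ (by omega) fun hle => ?_, by omega, hMp j (by omega) hjn⟩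
    rw [Nat.sub_add_cancel (by omega)] at hle
    exact (Finset.mem_filter.1 hj).2 hle.of_half
  obtain ⟨y, hy, z, hz, hyz⟩ := hMp (x - 1) (by omega) (by omega)
  rw [Nat.sub_add_cancel (by omega)] at hz
  have hy' : y ∈ ⋃ j ∈ S, M j := Set.mem_biUnion (t := fun j => M j) hxS hy
  have hz' : z ∈ ⋃ j ∈ T, M j := Set.mem_biUnion (t := fun j => M j) hxT hz
  rcases hx with ⟨hxf, hxl, hxc⟩ | ⟨hxf, hxl, hxc⟩
  · exact h.isMinor_doubleWheel hκ hMd hSn hTn hST hSc hTc ⟨y, hy', z, hz', hyz⟩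
      (hmemT _ hm0 hxf) (hmemT _ hm1 hxl) (hfilter _ hxc S hmemS)
  · exact h.isMinor_doubleWheel hκ hMd hTn hSn hST.symm hTc hSc ⟨z, hz', y, hy', hyz.symm⟩
      (hmemS _ hm0 hxf) (hmemS _ hm1 hxl) (hfilter (¬ HeapBelow x ·) (by convert hxc) T hmemT)

theorem isMinor_doubleWheel_of_le_treewidth [Fintype V] {G : SimpleGraph V} {n d κ ρ : ℕ}
    (hn : 0 < n) (hκ : 0 < κ) (hnd : n < 2 ^ (d + 1)) (hρ : κ * (2 * d + 1) ≤ 2 * ρ)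
    (hρn : 1 + ρ * (κ * (2 * d + 1)) < n) (htw : 8 * n - 1 ≤ treewidth G) :
    IsMinor (doubleWheel (κ + 1)) G := by
  obtain ⟨W, hWn, hW⟩ := exists_wellLinked_of_le_treewidth G (w := 6 * n - 1) (s := 2 * n)
    (by omega) (by omega)
  obtain ⟨M, K, a, b, hM, hMd, hMp, hK, hKd, hKM, ha, hai, hb, hbi, haK, hbK, hΓ⟩ :=
    exists_crossing hn hWn hW
      (par := fun j => if j < n then (j + 1) / 2 - 1 else if j = n then n else j - 1) (by
        intro j
        split_ifs <;> omega)
  obtain ⟨L, H, m, h⟩ := exists_strip (p := κ * (2 * d + 1) + 1) (ρ := ρ) hn (by omega)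
    (by simpa using hρn) hM hMd (fun j hj hj2 => by
      have := hMp j hj2
      simp only [hj.not_gt, hj.ne', if_false] at this
      exact this (by omega)) hK hKd hKM ha hai hb hbi haK hbK hΓ
  refine h.isMinor_of_heap hκ hnd (fun j hj => hM j (by omega))
    (fun j hj j' hj' => hMd j (by omega) j' (by omega)) fun j hj0 hjn => ?_
  have := hMp j (by omega)
  simp only [hjn, if_true] at this
  exact this (by omega)

theorem eight_mul_add_one_le_two_pow {l : ℕ} (hl : 4 ≤ l) : 8 * l + 1 ≤ 4 * 2 ^ l := by
  induction l, hl using Nat.le_induction with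
  | base => norm_num
  | succ l hl ih => rw [pow_succ]; omega

end GraphConn

/-- If `tw(G) ≥ 12(8k·log₂(8k) + 2)² - 4`, then `G` contains a double wheel of order
at least `k` as a minor. -/
theorem doubleWheel_minor_of_treewidth {V : Type*} [Fintype V] (k : ℕ) (hk : 0 < k)
    (G : SimpleGraph V)
    (htw : (treewidth G : ℝ) ≥ 12 * (8 * k * Real.logb 2 (8 * k) + 2) ^ 2 - 4) :
    ∃ r : ℕ, 2 < r ∧ k ≤ r ∧ IsMinor (doubleWheel r) G := by
  have hlog : (Nat.log 2 (8 * k) : ℝ) ≤ Real.logb 2 (8 * k) := by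
    exact_mod_cast Real.natLog_le_logb (8 * k) 2
  set l := Nat.log 2 (8 * k) with hl
  have hnat : 12 * (8 * k * l + 2) ^ 2 - 4 ≤ treewidth G := by
    rw [Nat.sub_le_iff_le_add]
    have h1 : (8 * k * l + 2 : ℝ) ≤ 8 * k * Real.logb 2 (8 * k) + 2 := by gcongr
    have h2 : (8 * k * l + 2 : ℝ) ^ 2 ≤ (8 * k * Real.logb 2 (8 * k) + 2) ^ 2 := by gcongr
    have h3 : (12 * (8 * k * l + 2) ^ 2 : ℝ) ≤ treewidth G + 4 := by linarith
    exact_mod_cast h3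
  have hkl : 2 ^ l ≤ 8 * k := Nat.pow_log_le_self 2 (by omega)
  have hkl' : 8 * k < 2 ^ (l + 1) := Nat.lt_pow_succ_log_self (by norm_num) _
  rcases Nat.lt_or_ge k 2 with hk2 | hk2
  · obtain rfl : k = 1 := by omega
    have hl3 : l = 3 := by
      rw [hl]
      exact Nat.log_pow (b := 2) (by norm_num) 3
    rw [hl3] at hnat
    exact ⟨3, by norm_num, by norm_num, GraphConn.isMinor_doubleWheel_of_le_treewidth (n := 1013)
      (d := 9) (κ := 2) (ρ := 19) (by norm_num) (by norm_num) (by norm_num) (by norm_num)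
      (by norm_num) (by omega)⟩
  · have hl4 : 4 ≤ l := Nat.le_log_of_pow_le (by norm_num) (by omega)
    have hE := GraphConn.eight_mul_add_one_le_two_pow hl4
    have hE16 : 2 ^ 4 ≤ 2 ^ l := Nat.pow_le_pow_right (by norm_num) hl4
    have hkE : 4 * k + 1 ≤ 2 ^ l := by rw [pow_succ] at hkl'; omega
    have hpow : 2 ^ (4 * l + 1) = 2 * (2 ^ l) ^ 4 := by rw [pow_succ, ← pow_mul]; ring_nf
    have hy : k * (2 * (4 * l) + 1) = 8 * (k * l) + k := by ring
    have hz : 4 * k ≤ k * l := by nlinarith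
    have htw' : 12 * (8 * (k * l) + 2) ^ 2 - 4 ≤ treewidth G := by rwa [← mul_assoc]
    refine ⟨k + 1, by omega, by omega, GraphConn.isMinor_doubleWheel_of_le_treewidth
      (n := 2 + (8 * (k * l) + k) ^ 2) (d := 4 * l) (κ := k) (ρ := k * (2 * (4 * l) + 1))
      (by omega) (by omega) ?_ (by omega) ?_ ?_⟩
    · rw [hpow]
      have h1 : 8 * (k * l) + k + 2 ≤ (2 ^ l) ^ 2 := by nlinarith
      nlinarith
    · rw [hy]; nlinarith
    · refine le_trans ?_ htw'
      have h1 : 4 * (8 * (k * l) + k) ≤ 33 * (k * l) := by omega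
      have h2 : 8 * (2 + (8 * (k * l) + k) ^ 2) + 3 ≤ 12 * (8 * (k * l) + 2) ^ 2 := by nlinarith
      omega
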